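/- arXiv:2407.10314 — 11 statements merged into one kernel-verified Lean document; each statement's English description precedes it below -/
import Mathlib

section
/- Let U be a 1-unconditional convex body in ℝⁿ and let x be a boundary point of U. If d ∈ ℝⁿ satisfies {i : d_i = 0} = {i : x_i = 0} and d_i·x_i < 0 for every i with x_i ≠ 0, then d illuminates x, i.e., there exists ε > 0 with x + εd in the interior of U. In particular, the set {−1,0,1}ⁿ \ {0} illuminates U: every boundary point of U is illuminated by some vector all of whose coordinates lie in {−1,0,1} and which is not the zero vector. -/
open Filter Topology

/-- A set is 1-unconditional if it is stable under arbitrary sign changes of the coordinates. -/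
def OneUnconditional {ι : Type*} (U : Set (ι → ℝ)) : Prop :=
  ∀ x ∈ U, ∀ ε : ι → ℝ, (∀ i, ε i = 1 ∨ ε i = -1) → (fun i => ε i * x i) ∈ U

namespace OneUnconditional

variable {ι : Type*} {U : Set (ι → ℝ)}

theorem neg_mem (hU : OneUnconditional U) {x : ι → ℝ} (hx : x ∈ U) : -x ∈ U := by
  convert hU x hx (fun _ => -1) (fun _ => Or.inr rfl) using 1
  ext i
  simp

/-- A convex 1-unconditional set is solid. -/
theorem mem_of_abs_le [Finite ι] (hU : OneUnconditional U) (hconv : Convex ℝ U) {y z : ι → ℝ}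
    (hy : y ∈ U) (h : ∀ i, |z i| ≤ |y i|) : z ∈ U := by
  classical
  have := Fintype.ofFinite ι
  suffices H : ∀ (s : Finset ι) (z : ι → ℝ), (∀ i, |z i| ≤ |y i|) → (∀ i ∉ s, z i = y i) → z ∈ U
    from H Finset.univ z h (by simp)
  intro s
  induction s using Finset.induction_on with
  | empty =>
    intro z _ hz
    rwa [show z = y from funext fun i => hz i (by simp)]
  | insert a s _ ih =>
    intro z hle hz
    have hp : Function.update z a (y a) ∈ U := by
      refine ih _ (fun i => ?_) (fun i hi => ?_) <;> by_cases hia : i = a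
      · subst hia; simp
      · simpa [hia] using hle i
      · subst hia; simp
      · simpa [hia] using hz i (by simp [hia, hi])
    have hm : Function.update z a (-y a) ∈ U := by
      convert hU _ hp (Function.update (fun _ => 1) a (-1))
        (fun i => by by_cases hia : i = a <;> simp [hia]) using 1
      ext i
      by_cases hia : i = a
      · subst hia; simp
      · simp [hia]
    obtain ⟨t, ht, hzt⟩ : ∃ t : ℝ, |t| ≤ 1 ∧ z a = t * y a := by
      by_cases hya : y a = 0
      · exact ⟨0, by simp, by simpa [hya] using hle a⟩
      · refine ⟨z a / y a, ?_, by field_simp⟩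
        rw [abs_div]
        exact div_le_one_of_le₀ (hle a) (abs_nonneg _)
    rw [abs_le] at ht
    convert hconv hp hm (a := (1 + t) / 2) (b := (1 - t) / 2) (by linarith) (by linarith)
      (by ring) using 1
    ext i
    by_cases hia : i = a
    · subst hia
      simp only [Pi.add_apply, Pi.smul_apply, Function.update_self, smul_eq_mul]
      linear_combination hzt
    · simp only [Pi.add_apply, Pi.smul_apply, Function.update_of_ne hia, smul_eq_mul]
      ring

theorem zero_mem_interior (hU : OneUnconditional U) (hconv : Convex ℝ U)
    (hint : (interior U).Nonempty) : (0 : ι → ℝ) ∈ interior U := by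
  obtain ⟨p, hp⟩ := hint
  simpa using hconv.combo_interior_self_mem_interior hp (hU.neg_mem (interior_subset hp))
    (a := 1 / 2) (b := 1 / 2) (by norm_num) (by norm_num) (by norm_num)

/-- Points that are coordinatewise strictly smaller than a point of `U`, off its zero set, are
interior points. -/
theorem mem_interior_of_abs_lt [Finite ι] (hU : OneUnconditional U) (hconv : Convex ℝ U)
    (hint : (interior U).Nonempty) {x y : ι → ℝ} (hx : x ∈ U) (h0 : ∀ i, x i = 0 → y i = 0)
    (hlt : ∀ i, x i ≠ 0 → |y i| < |x i|) : y ∈ interior U := by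
  have hev : ∀ᶠ η : ℝ in 𝓝[>] 0, ∀ i, |y i| ≤ (1 - η) * |x i| := by
    rw [eventually_all]
    intro i
    by_cases hxi : x i = 0
    · simp [hxi, h0 i hxi]
    · have hc : Tendsto (fun η : ℝ => (1 - η) * |x i|) (𝓝[>] 0) (𝓝 |x i|) :=
        (Continuous.tendsto' (by fun_prop) _ _ (by simp)).mono_left nhdsWithin_le_nhds
      exact (hc.eventually_const_lt (hlt i hxi)).mono fun _ => le_of_lt
  obtain ⟨η, ⟨hη, hη0⟩, hη1⟩ :=
    ((hev.and self_mem_nhdsWithin).and (Ioo_mem_nhdsGT one_pos)).exists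
  have hpos : 0 < 1 - η := sub_pos.2 hη1.2
  have hmem : (1 - η)⁻¹ • y ∈ U := by
    refine hU.mem_of_abs_le hconv hx fun i => ?_
    rw [Pi.smul_apply, smul_eq_mul, abs_mul, abs_of_pos (inv_pos.2 hpos), inv_mul_le_iff₀ hpos]
    exact hη i
  simpa [smul_smul, hpos.ne'] using hconv.combo_interior_self_mem_interior
    (hU.zero_mem_interior hconv hint) hmem hη0 hpos.le (by ring)

/-- A direction with the zero set of `x` and signs opposite to those of `x` points from `x` into
the interior. -/
theorem exists_add_smul_mem_interior [Finite ι] (hU : OneUnconditional U) (hconv : Convex ℝ U)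
    (hint : (interior U).Nonempty) {x d : ι → ℝ} (hx : x ∈ U) (h0 : ∀ i, x i = 0 → d i = 0)
    (hlt : ∀ i, x i ≠ 0 → d i * x i < 0) : ∃ ε : ℝ, 0 < ε ∧ x + ε • d ∈ interior U := by
  have hev : ∀ᶠ ε : ℝ in 𝓝[>] 0, ∀ i, x i ≠ 0 → |x i + ε * d i| < |x i| := by
    rw [eventually_all]
    intro i
    by_cases hxi : x i = 0
    · simp [hxi]
    · have hc : Tendsto (fun ε : ℝ => 2 * (d i * x i) + ε * d i ^ 2) (𝓝[>] 0)
          (𝓝 (2 * (d i * x i))) :=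
        (Continuous.tendsto' (by fun_prop) _ _ (by simp)).mono_left nhdsWithin_le_nhds
      filter_upwards [hc.eventually_lt_const (by linarith [hlt i hxi] : _ < (0 : ℝ)),
        self_mem_nhdsWithin] with ε hε hε0 _
      rw [← sq_lt_sq]
      linarith [mul_neg_of_pos_of_neg hε0 hε,
        show (x i + ε * d i) ^ 2 = x i ^ 2 + ε * (2 * (d i * x i) + ε * d i ^ 2) by ring]
  obtain ⟨ε, hε, hε0⟩ := (hev.and self_mem_nhdsWithin).exists
  exact ⟨ε, hε0, hU.mem_interior_of_abs_lt hconv hint hx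
    (fun i hi => by simp [hi, h0 i hi]) (fun i hi => by simpa using hε i hi)⟩

end OneUnconditional

/-- Corollary: a boundary point `x` of a 1-unconditional convex body is illuminated by any
direction `d` whose zero set coincides with that of `x` and whose nonzero coordinates have
signs opposite to those of `x`; in particular `{-1,0,1}ⁿ \ {0}` illuminates the body. -/
theorem stmt_1 {n : ℕ} (U : Set (Fin n → ℝ))
    (hU_conv : Convex ℝ U) (hU_comp : IsCompact U) (hU_int : (interior U).Nonempty)
    (hU_uncond : ∀ x ∈ U, ∀ ε : Fin n → ℝ, (∀ i, ε i = 1 ∨ ε i = -1) →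
      (fun i => ε i * x i) ∈ U)
    (x : Fin n → ℝ) (hx : x ∈ frontier U) :
    (∀ d : Fin n → ℝ, (∀ i, d i = 0 ↔ x i = 0) →
      (∀ i, x i ≠ 0 → d i * x i < 0) →
      ∃ ε : ℝ, 0 < ε ∧ x + ε • d ∈ interior U) ∧
    (∃ d : Fin n → ℝ, d ≠ 0 ∧ (∀ i, d i = -1 ∨ d i = 0 ∨ d i = 1) ∧
      ∃ ε : ℝ, 0 < ε ∧ x + ε • d ∈ interior U) := by
  have hU : OneUnconditional U := hU_uncond
  have hxU : x ∈ U := hU_comp.isClosed.frontier_subset hx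
  have illum : ∀ d : Fin n → ℝ, (∀ i, d i = 0 ↔ x i = 0) → (∀ i, x i ≠ 0 → d i * x i < 0) →
      ∃ ε : ℝ, 0 < ε ∧ x + ε • d ∈ interior U := fun d h0 hlt =>
    hU.exists_add_smul_mem_interior hU_conv hU_int hxU (fun i => (h0 i).2) hlt
  have hx0 : x ≠ 0 := by
    rintro rfl
    exact hx.2 (hU.zero_mem_interior hU_conv hU_int)
  obtain ⟨j, hj⟩ := Function.ne_iff.1 hx0
  have hsign : ∀ i, -(SignType.sign (x i) : ℝ) = 0 ↔ x i = 0 := fun i => by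
    rcases lt_trichotomy (x i) 0 with h | h | h
    · simp [h, h.ne]
    · simp [h]
    · simp [h, h.ne']
  refine ⟨illum, fun i => -(SignType.sign (x i) : ℝ), ?_, fun i => ?_, illum _ hsign fun i hi => ?_⟩
  · exact Function.ne_iff.2 ⟨j, (hsign j).not.2 hj⟩
  · rcases lt_trichotomy (x i) 0 with h | h | h <;> simp [h]
  · rw [neg_mul, sign_mul_self]
    exact neg_neg_of_pos (abs_pos.2 hi)
end

section
/- Let B be a 1-symmetric convex body in ℝⁿ and let x be a boundary point of B. Suppose there is a unique index i₀ ∈ {1,…,n} such that |x_{i₀}| = max_i |x_i|. Then x is illuminated by the direction −sign(x_{i₀})·e_{i₀}, i.e., there exists ε > 0 with x − ε·sign(x_{i₀})·e_{i₀} in the interior of B. -/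
/-- If every continuous linear functional bounded above on a convex set with nonempty interior by
its value at `y` is constant there, then `y` lies in the interior of that set. -/
theorem Convex.mem_interior_of_forall_eq_of_forall_le {n : ℕ} {B : Set (Fin n → ℝ)}
    (hB_conv : Convex ℝ B) (hB_int : (interior B).Nonempty) (y : Fin n → ℝ)
    (h : ∀ f : (Fin n → ℝ) →L[ℝ] ℝ, (∀ b ∈ B, f b ≤ f y) → ∀ b ∈ B, f b = f y) : y ∈ interior B := by
  by_contra hy
  obtain ⟨f, hf⟩ := geometric_hahn_banach_open_point hB_conv.interior isOpen_interior hy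
  have hle : ∀ b ∈ B, f b ≤ f y := by
    intro b hb
    have hb' : b ∈ closure (interior B) := by
      rw [hB_conv.closure_interior_eq_closure_of_nonempty_interior hB_int]
      exact subset_closure hb
    exact closure_minimal (fun z hz => (hf z hz).le)
      (isClosed_le f.continuous continuous_const) hb'
  obtain ⟨b, hb⟩ := hB_int
  exact (hf b hb).ne (h f hle b (interior_subset hb))

/-- Lemma: if a boundary point `x` of a 1-symmetric convex body has a unique maximal
(in absolute value) coordinate, at index `i₀`, then `x` is illuminated by
`-sign(x i₀) • e i₀`. -/
theorem stmt_2 {n : ℕ} (B : Set (Fin n → ℝ))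
    (hB_conv : Convex ℝ B) (hB_comp : IsCompact B) (hB_int : (interior B).Nonempty)
    (hB_sym : ∀ x ∈ B, ∀ σ : Equiv.Perm (Fin n), ∀ ε : Fin n → ℝ,
      (∀ i, ε i = 1 ∨ ε i = -1) → (fun i => ε i * x (σ i)) ∈ B)
    (x : Fin n → ℝ) (hx : x ∈ frontier B) (i₀ : Fin n)
    (hmax : ∀ i, i ≠ i₀ → |x i| < |x i₀|) :
    ∃ ε : ℝ, 0 < ε ∧
      x + ε • ((-(Real.sign (x i₀))) • (Pi.single i₀ (1 : ℝ) : Fin n → ℝ)) ∈ interior B := by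
  have hxB : x ∈ B := hB_comp.isClosed.frontier_subset hx
  have hx₀ : x i₀ ≠ 0 := by
    intro h0
    have hx0 : x = 0 := by
      funext i
      by_cases hi : i = i₀
      · simp [hi, h0]
      · have := hmax i hi
        rw [h0, abs_zero] at this
        exact absurd this (abs_nonneg _).not_gt
    refine hx.2 (hB_conv.mem_interior_of_forall_eq_of_forall_le hB_int x fun f hf b hb => ?_)
    have hB0 : ∀ b ∈ B, f b = 0 := by
      intro b hb
      have hneg := hf _ (hB_sym b hb 1 (fun _ => -1) fun _ => Or.inr rfl)
      have hneg' : (fun i => -1 * b ((1 : Equiv.Perm (Fin n)) i)) = -b := by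
        funext i; simp
      have hpos := hf b hb
      rw [hneg', map_neg] at hneg
      rw [hx0, map_zero] at hneg hpos
      linarith
    rw [hB0 b hb, hx0, map_zero]
  refine ⟨|x i₀|, abs_pos.2 hx₀, ?_⟩
  have hsign : |x i₀| * Real.sign (x i₀) = x i₀ := by
    rcases lt_or_gt_of_ne hx₀ with h | h
    · simp [Real.sign_of_neg h, abs_of_neg h]
    · simp [Real.sign_of_pos h, abs_of_pos h]
  have hy : x + |x i₀| • ((-(Real.sign (x i₀))) • (Pi.single i₀ (1 : ℝ) : Fin n → ℝ))
      = x - x i₀ • Pi.single i₀ (1 : ℝ) := by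
    rw [smul_smul, mul_neg, hsign, neg_smul, sub_eq_add_neg]
  rw [hy]
  refine hB_conv.mem_interior_of_forall_eq_of_forall_le hB_int _ fun f hf => ?_
  have hf₀ : f (Pi.single i₀ 1) = 0 := by
    have h1 := hf x hxB
    have h2 := hf _ (hB_sym x hxB 1 (fun i => if i = i₀ then -1 else 1)
      fun i => by by_cases h : i = i₀ <;> simp [h])
    have hrefl : (fun i => (if i = i₀ then -1 else 1) * x ((1 : Equiv.Perm (Fin n)) i))
        = x - (2 * x i₀) • Pi.single i₀ (1 : ℝ) := by
      funext i
      by_cases h : i = i₀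
      · subst h; simp; ring
      · simp [h]
    rw [hrefl] at h2
    simp only [map_sub, map_smul, smul_eq_mul] at h1 h2
    have : x i₀ * f (Pi.single i₀ 1) = 0 := by linarith
    exact (mul_eq_zero.1 this).resolve_left hx₀
  have hfj : ∀ j, f (Pi.single j 1) = 0 := by
    intro j
    by_cases hj : j = i₀
    · rw [hj, hf₀]
    have key : ∀ δ : ℝ, (δ = 1 ∨ δ = -1) →
        (δ * x i₀ - x j) * f (Pi.single j 1) ≤ 0 := by
      intro δ hδ
      have hle := hf _ (hB_sym x hxB (Equiv.swap i₀ j) (fun i => if i = j then δ else 1)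
        fun i => by by_cases h : i = j <;> simp [h, hδ])
      have hswap : (fun i => (if i = j then δ else 1) * x (Equiv.swap i₀ j i))
          = x + (δ * x i₀ - x j) • Pi.single j (1 : ℝ)
            + (x j - x i₀) • Pi.single i₀ (1 : ℝ) := by
        funext i
        by_cases h : i = j
        · subst h; simp [hj]
        · by_cases h' : i = i₀
          · subst h'; simp [h]
          · simp [h, h', Equiv.swap_apply_of_ne_of_ne h' h]
      rw [hswap] at hle
      simp only [map_sub, map_add, map_smul, smul_eq_mul, hf₀] at hle
      linarith
    have h1 := key 1 (Or.inl rfl)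
    have h2 := key (-1) (Or.inr rfl)
    have hlt := hmax j hj
    by_contra hne
    rcases lt_or_gt_of_ne hne with hn | hp <;>
      rcases abs_cases (x i₀) with ⟨e, _⟩ | ⟨e, _⟩ <;>
      rw [e] at hlt <;>
      obtain ⟨ha, hb⟩ := abs_lt.1 hlt <;>
      nlinarith
  have hf_zero : f = 0 := by
    ext v
    have hv : v = ∑ j, v j • (Pi.single j (1 : ℝ) : Fin n → ℝ) := pi_eq_sum_univ' v
    rw [hv]
    simp only [map_sum, map_smul, hfj, smul_zero, Finset.sum_const_zero,
      zero_apply]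
  simp [hf_zero]
end

section
/- Let U be a 1-unconditional convex body in ℝⁿ such that each standard basis vector e_i lies on the boundary of U, and suppose that the point (1/2, 1/2, …, 1/2) lies in the interior of U. Then U is illuminated by the set {−1,1}ⁿ: for every boundary point x of U there exists d ∈ {−1,1}ⁿ and ε > 0 with x + εd in the interior of U. -/
/-- The interior of a set invariant under sign changes of the coordinates is invariant too. -/
theorem mul_mem_interior_of_unconditional {n : ℕ} {U : Set (Fin n → ℝ)}
    (hU : ∀ x ∈ U, ∀ ε : Fin n → ℝ, (∀ i, ε i = 1 ∨ ε i = -1) → (fun i => ε i * x i) ∈ U)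
    {x : Fin n → ℝ} (hx : x ∈ interior U) {ε : Fin n → ℝ} (hε : ∀ i, ε i = 1 ∨ ε i = -1) :
    (fun i => ε i * x i) ∈ interior U := by
  have hinv : ∀ y : Fin n → ℝ, (fun i => ε i * (ε i * y i)) = y := fun y => by
    funext i
    rcases hε i with h | h <;> simp [h]
  have hcont : Continuous fun (y : Fin n → ℝ) i => ε i * y i := by fun_prop
  refine interior_maximal (s := U) (t := (fun (y : Fin n → ℝ) i => ε i * y i) ⁻¹' interior U)
    (fun y hy => ?_) (isOpen_interior.preimage hcont) ?_
  · simpa only [hinv] using hU _ (interior_subset hy) ε hε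
  · simpa only [Set.mem_preimage, hinv] using hx

/-- An unconditional convex set with `(1/2, …, 1/2)` in its interior contains the cube
`[-1/2, 1/2]ⁿ` in its interior. -/
theorem mem_interior_of_abs_le_half {n : ℕ} {U : Set (Fin n → ℝ)} (hconv : Convex ℝ U)
    (hU : ∀ x ∈ U, ∀ ε : Fin n → ℝ, (∀ i, ε i = 1 ∨ ε i = -1) → (fun i => ε i * x i) ∈ U)
    (hhalf : (fun _ : Fin n => (1 / 2 : ℝ)) ∈ interior U)
    {y : Fin n → ℝ} (hy : ∀ i, |y i| ≤ 1 / 2) : y ∈ interior U := by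
  have hvert : Set.univ.pi (fun _ : Fin n => ({-(1 / 2), 1 / 2} : Set ℝ)) ⊆ interior U := by
    intro v hv
    have hsign : ∀ i, 2 * v i = 1 ∨ 2 * v i = -1 := fun i => by
      rcases hv i (Set.mem_univ i) with h | h
      · right; rw [h]; norm_num
      · left; rw [h]; norm_num
    convert mul_mem_interior_of_unconditional hU hhalf hsign using 1
    funext i
    ring
  apply convexHull_min hvert hconv.interior
  rw [convexHull_pi]
  intro i _
  rw [convexHull_pair, segment_eq_Icc (by norm_num)]
  exact abs_le.mp (hy i)

/-- If `0` is interior to an unconditional convex set and the `i`-th basis vector is not, then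
the `i`-th coordinate is bounded by `1` on the set. -/
theorem abs_coord_le_one {n : ℕ} {U : Set (Fin n → ℝ)} (hconv : Convex ℝ U)
    (hU : ∀ x ∈ U, ∀ ε : Fin n → ℝ, (∀ i, ε i = 1 ∨ ε i = -1) → (fun i => ε i * x i) ∈ U)
    (hzero : (0 : Fin n → ℝ) ∈ interior U) {i : Fin n}
    (hi : (Pi.single i (1 : ℝ) : Fin n → ℝ) ∉ interior U)
    {x : Fin n → ℝ} (hx : x ∈ U) : |x i| ≤ 1 := by
  by_contra! hlt
  obtain ⟨s, hs, hsx⟩ : ∃ s : ℝ, (s = 1 ∨ s = -1) ∧ s * x i = |x i| := by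
    rcases abs_choice (x i) with h | h
    · exact ⟨1, .inl rfl, by linarith⟩
    · exact ⟨-1, .inr rfl, by linarith⟩
  have hσ : ∀ j, (if j = i then s else -s) = 1 ∨ (if j = i then s else -s) = -1 := fun j => by
    split_ifs
    · exact hs
    · rcases hs with h | h <;> simp [h]
  have hp : (Pi.single i |x i| : Fin n → ℝ) ∈ U := by
    convert hconv (hU x hx (fun _ => s) fun _ => hs) (hU x hx _ hσ)
      (by norm_num : (0 : ℝ) ≤ 1 / 2) (by norm_num : (0 : ℝ) ≤ 1 / 2) (by norm_num) using 1
    funext j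
    by_cases hj : j = i
    · subst hj
      simp only [Pi.single_eq_same, Pi.add_apply, Pi.smul_apply, smul_eq_mul, if_true]
      linarith
    · simp only [Pi.single_eq_of_ne hj, Pi.add_apply, Pi.smul_apply, smul_eq_mul, if_neg hj]
      ring
  have hpos : 0 < |x i| := by linarith
  apply hi
  convert hconv.combo_interior_self_mem_interior hzero hp
    (sub_pos.mpr (inv_lt_one_of_one_lt₀ hlt)) (inv_pos.mpr hpos).le (by ring) using 1
  rw [smul_zero, zero_add, ← Pi.single_smul, smul_eq_mul, inv_mul_cancel₀ hpos.ne']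


/-- Lemma: a 1-unconditional convex body `U` with all standard basis vectors on its
boundary and with `(1/2, …, 1/2)` in its interior is illuminated by `{-1,1}ⁿ`. -/
theorem stmt_5 {n : ℕ} (U : Set (Fin n → ℝ))
    (hU_conv : Convex ℝ U) (hU_comp : IsCompact U) (hU_int : (interior U).Nonempty)
    (hU_uncond : ∀ x ∈ U, ∀ ε : Fin n → ℝ, (∀ i, ε i = 1 ∨ ε i = -1) →
      (fun i => ε i * x i) ∈ U)
    (hU_norm : ∀ i : Fin n, (Pi.single i (1 : ℝ) : Fin n → ℝ) ∈ frontier U)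
    (hhalf : (fun _ : Fin n => (1 / 2 : ℝ)) ∈ interior U) :
    ∀ x ∈ frontier U, ∃ d : Fin n → ℝ, (∀ i, d i = 1 ∨ d i = -1) ∧
      ∃ ε : ℝ, 0 < ε ∧ x + ε • d ∈ interior U := by
  intro x hx
  have hxU : x ∈ U := hU_comp.isClosed.frontier_subset hx
  have hzero : (0 : Fin n → ℝ) ∈ interior U :=
    mem_interior_of_abs_le_half hU_conv hU_uncond hhalf (by simp)
  refine ⟨fun i => if 0 < x i then -1 else 1, fun i => ?_, 1 / 2, by norm_num, ?_⟩
  · dsimp only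
    split_ifs <;> simp
  · refine mem_interior_of_abs_le_half hU_conv hU_uncond hhalf fun i => ?_
    have hxi := abs_le.mp (abs_coord_le_one hU_conv hU_uncond hzero (hU_norm i).2 hxU)
    simp only [Pi.add_apply, Pi.smul_apply, smul_eq_mul]
    rw [abs_le]
    split_ifs <;> constructor <;> linarith
end

section
/- Let n ≥ 3, let B be a 1-symmetric convex body in ℝⁿ with each standard basis vector e_i on its boundary, and let x be a boundary point of B with x_k ≠ 0 for some index k. Let δ ∈ (0, 1/n) and let d ∈ ℝⁿ satisfy d_k = −sign(x_k) and, for every i ≠ k, |d_i| = δ and d_i·x_i ≤ 0 (the sign of d_i being arbitrary when x_i = 0). Then d illuminates x: there exists ε > 0 with x + εd in the interior of B. -/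
/-- A convex set closed under coordinatewise sign changes contains, in its interior, the open box
spanned by any of its points. -/
theorem mem_interior_of_abs_lt {ι : Type*} [Fintype ι] {B : Set (ι → ℝ)} (hconv : Convex ℝ B)
    (hsign : ∀ x ∈ B, ∀ ε : ι → ℝ, (∀ i, ε i = 1 ∨ ε i = -1) → (fun i => ε i * x i) ∈ B)
    {w y : ι → ℝ} (hw : w ∈ B) (hy : ∀ i, |y i| < w i) : y ∈ interior B := by
  have hvert : Set.pi Set.univ (fun i => ({-w i, w i} : Set ℝ)) ⊆ B := by
    intro z hz
    have hpos : ∀ i, 0 < w i := fun i => (abs_nonneg _).trans_lt (hy i)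
    convert hsign w hw (fun i => z i / w i) ?_ using 1
    · funext i
      exact (div_mul_cancel₀ _ (hpos i).ne').symm
    · intro i
      rcases hz i (Set.mem_univ i) with h | h
      · exact Or.inr (by rw [h, neg_div, div_self (hpos i).ne'])
      · exact Or.inl (by rw [h, div_self (hpos i).ne'])
  have hbox : Set.pi Set.univ (fun i => Set.Ioo (-w i) (w i)) ⊆ B := by
    refine subset_trans ?_ (convexHull_min hvert hconv)
    rw [convexHull_pi]
    refine Set.pi_mono fun i _ t ht => ?_
    rw [convexHull_pair, segment_eq_Icc (ht.1.trans ht.2).le]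
    exact Set.Ioo_subset_Icc_self ht
  refine interior_maximal hbox (isOpen_set_pi Set.finite_univ fun _ _ => isOpen_Ioo) ?_
  exact fun i _ => abs_lt.1 (hy i)

/-- Averaging a nonnegative point with its transpositions spreads the mass of the coordinate `k`
over the coordinates that vanish. -/
theorem exists_mem_spread {n : ℕ} {B : Set (Fin n → ℝ)} (hconv : Convex ℝ B)
    (hperm : ∀ x ∈ B, ∀ σ : Equiv.Perm (Fin n), (fun i => x (σ i)) ∈ B)
    {a : Fin n → ℝ} (ha : a ∈ B) (hnonneg : ∀ i, 0 ≤ a i) (k : Fin n) :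
    ∃ v ∈ B, (∀ i, a i ≠ 0 → i ≠ k → v i = a i) ∧
      ∀ i, (i = k ∨ a i = 0) → a k / n ≤ v i := by
  have hn : (0 : ℝ) < n := Nat.cast_pos.2 k.pos
  let q : Fin n → Fin n → ℝ := fun j => if a j = 0 then fun i => a (Equiv.swap k j i) else a
  have hq : ∀ j, q j ∈ B := by
    intro j
    by_cases h : a j = 0
    · simpa only [q, if_pos h] using hperm a ha (Equiv.swap k j)
    · simpa only [q, if_neg h] using ha
  have hq_nonneg : ∀ j i, 0 ≤ q j i := by
    intro j i
    by_cases h : a j = 0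
    · simpa only [q, if_pos h] using hnonneg _
    · simpa only [q, if_neg h] using hnonneg _
  refine ⟨∑ j, (1 / n : ℝ) • q j, hconv.sum_mem (fun _ _ => by positivity) ?_ fun j _ => hq j,
    ?_, ?_⟩
  · simp [hn.ne']
  · intro i hi hik
    have hqi : ∀ j, q j i = a i := by
      intro j
      by_cases h : a j = 0
      · have hij : i ≠ j := fun hij => hi (hij ▸ h)
        simp only [q, if_pos h, Equiv.swap_apply_of_ne_of_ne hik hij]
      · simp only [q, if_neg h]
    simp [Finset.sum_apply, hqi, hn.ne']
  · intro i hi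
    have hqi : q i i = a k := by
      by_cases h : a i = 0
      · simp only [q, if_pos h, Equiv.swap_apply_right]
      · obtain rfl := hi.resolve_right h
        simp only [q, if_neg h]
    have hle := Finset.single_le_sum (f := fun j => (1 / n : ℝ) * q j i)
      (fun j _ => mul_nonneg (by positivity) (hq_nonneg j i)) (Finset.mem_univ i)
    simp only [Finset.sum_apply, Pi.smul_apply, smul_eq_mul]
    calc a k / n = 1 / n * q i i := by rw [hqi]; ring
      _ ≤ _ := hle


/-- Lemma (simple deep illumination): let `n ≥ 3`, `B ∈ 𝒮ⁿ`, `x ∈ ∂B` with `x k ≠ 0`.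
For `δ ∈ (0, 1/n)`, the point `x` is illuminated by any direction `d` with
`d k = -sign (x k)` and, for `i ≠ k`, `|d i| = δ` and `d i * x i ≤ 0`. -/
theorem stmt_7 {n : ℕ} (hn : 3 ≤ n) (B : Set (Fin n → ℝ))
    (hB_conv : Convex ℝ B) (hB_comp : IsCompact B) (hB_int : (interior B).Nonempty)
    (hB_sym : ∀ x ∈ B, ∀ σ : Equiv.Perm (Fin n), ∀ ε : Fin n → ℝ,
      (∀ i, ε i = 1 ∨ ε i = -1) → (fun i => ε i * x (σ i)) ∈ B)
    (hB_norm : ∀ i : Fin n, (Pi.single i (1 : ℝ) : Fin n → ℝ) ∈ frontier B)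
    (x : Fin n → ℝ) (hx : x ∈ frontier B) (k : Fin n) (hxk : x k ≠ 0)
    (δ : ℝ) (hδ0 : 0 < δ) (hδn : δ < 1 / n)
    (d : Fin n → ℝ) (hdk : d k = -Real.sign (x k))
    (hdi : ∀ i, i ≠ k → |d i| = δ ∧ d i * x i ≤ 0) :
    ∃ ε : ℝ, 0 < ε ∧ x + ε • d ∈ interior B := by
  have hsign : ∀ x ∈ B, ∀ ε : Fin n → ℝ, (∀ i, ε i = 1 ∨ ε i = -1) →
      (fun i => ε i * x i) ∈ B := fun x hx ε hε => hB_sym x hx 1 ε hε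
  have hperm : ∀ x ∈ B, ∀ σ : Equiv.Perm (Fin n), (fun i => x (σ i)) ∈ B := fun x hx σ => by
    simpa using hB_sym x hx σ (fun _ => 1) fun _ => Or.inl rfl
  have hxB : x ∈ B := hB_comp.isClosed.frontier_subset hx
  have habs : (fun i => |x i|) ∈ B := by
    convert hsign x hxB (fun i => if 0 ≤ x i then 1 else -1) ?_ using 1
    · funext i
      split_ifs with h
      · rw [abs_of_nonneg h, one_mul]
      · rw [abs_of_neg (not_le.1 h), neg_one_mul]
    · intro i
      by_cases h : 0 ≤ x i <;> simp [h]
  obtain ⟨v, hvB, hv_eq, hv_ge⟩ :=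
    exists_mem_spread hB_conv hperm habs (fun i => abs_nonneg (x i)) k
  obtain ⟨ε, hε_lt, hε⟩ : ∃ ε : ℝ, (∀ i, x i ≠ 0 → ε < |x i|) ∧ 0 < ε := by
    have hev : ∀ᶠ ε in nhdsWithin (0 : ℝ) (Set.Ioi 0), ∀ i, x i ≠ 0 → ε < |x i| := by
      refine Filter.eventually_all.2 fun i => ?_
      by_cases h : x i = 0
      · simp [h]
      · filter_upwards [nhdsWithin_le_nhds (Iio_mem_nhds (abs_pos.2 h))] with ε hε _
        exact hε
    exact (hev.and self_mem_nhdsWithin).exists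
  have hk : 0 < |x k| := abs_pos.2 hxk
  have hεk : ε < |x k| := hε_lt k hxk
  have hn0 : (0 : ℝ) < n := Nat.cast_pos.2 k.pos
  have hδ1 : δ < 1 := hδn.trans_le <| by
    rw [div_le_one hn0]
    exact_mod_cast k.pos
  have hs : 0 < ε / |x k| := div_pos hε hk
  have hs1 : ε / |x k| ≤ 1 := (div_le_one hk).2 hεk.le
  have hw := hB_conv habs hvB (sub_nonneg.2 hs1) hs.le (sub_add_cancel _ _)
  have hmass : ∀ i, |x k| / n ≤ v i → ε / n ≤ ε / |x k| * v i := fun i hi => by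
    calc ε / n = ε / |x k| * (|x k| / n) := by field_simp
      _ ≤ _ := mul_le_mul_of_nonneg_left hi hs.le
  refine ⟨ε, hε, mem_interior_of_abs_lt hB_conv hsign hw fun i => ?_⟩
  simp only [Pi.add_apply, Pi.smul_apply, smul_eq_mul]
  by_cases hik : i = k
  · subst hik
    have hv := hmass i (hv_ge i (Or.inl rfl))
    have hcancel : ε / |x i| * |x i| = ε := div_mul_cancel₀ _ hk.ne'
    have hεn : 0 < ε / n := div_pos hε hn0
    have hval : |x i + ε * d i| = |x i| - ε := by
      rcases lt_or_gt_of_ne hxk with h | h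
      · rw [abs_of_neg h] at hεk ⊢
        rw [hdk, Real.sign_of_neg h, abs_of_nonpos (by linarith)]
        ring
      · rw [abs_of_pos h] at hεk ⊢
        rw [hdk, Real.sign_of_pos h, abs_of_nonneg (by linarith)]
        ring
    rw [hval]
    linarith
  · obtain ⟨hd, hdx⟩ := hdi i hik
    by_cases hi : x i = 0
    · have hv := hmass i (hv_ge i (Or.inr (by rw [hi, abs_zero])))
      have hlt : ε * δ < ε / n := by
        calc ε * δ < ε * (1 / n) := mul_lt_mul_of_pos_left hδn hε
          _ = ε / n := by ring
      rw [hi, zero_add, abs_mul, hd, abs_of_pos hε, abs_zero, mul_zero, zero_add]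
      linarith
    · rw [hv_eq i (abs_ne_zero.2 hi) hik, ← add_mul, sub_add_cancel, one_mul]
      have hεi := hε_lt i hi
      have hεδ : ε * δ < ε := mul_lt_of_lt_one_right hε hδ1
      have hεδ0 : 0 < ε * δ := mul_pos hε hδ0
      rcases lt_or_gt_of_ne hi with h | h
      · have hd' : d i = δ := by rw [← hd, abs_of_nonneg (by nlinarith)]
        rw [abs_of_neg h] at hεi ⊢
        rw [hd', abs_lt]
        constructor <;> linarith
      · have hd' : d i = -δ := by rw [← hd, abs_of_nonpos (by nlinarith), neg_neg]
        rw [abs_of_pos h] at hεi ⊢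
        rw [hd', abs_lt]
        constructor <;> linarith
end

section
/- Let n ≥ 3, let B be a 1-symmetric convex body in ℝⁿ with each standard basis vector e_i on its boundary, and let x be a boundary point of B. Write M_x = {k : |x_k| = max_i |x_i|} and let k₀ ∈ M_x. Then for any δ ∈ (0, 1/n) and any direction d ∈ ℝⁿ with d_{k₀} = −sign(x_{k₀}), d_k = −δ·sign(x_k) for every k ∈ M_x \ {k₀}, and |d_i| = δ with arbitrary sign for every i ∉ M_x, the direction d illuminates x: there exists ε > 0 with x + εd in the interior of B. -/
/-- A direction that is strictly decreasing for every nonzero functional supporting `B` at `x`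
illuminates `x`. -/
theorem exists_add_smul_mem_interior_of_normal {E : Type*} [TopologicalSpace E] [AddCommGroup E]
    [IsTopologicalAddGroup E] [Module ℝ E] [ContinuousSMul ℝ E] {B : Set E}
    (hconv : Convex ℝ B) (hint : (interior B).Nonempty) {x d : E} (hx : x ∈ closure B)
    (h : ∀ f : E →L[ℝ] ℝ, f ≠ 0 → (∀ y ∈ B, f y ≤ f x) → f d < 0) :
    ∃ ε : ℝ, 0 < ε ∧ x + ε • d ∈ interior B := by
  by_contra! hcon
  have hray : Convex ℝ ((fun t : ℝ => x + t • d) '' Set.Ioi 0) := by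
    have := (convex_Ioi (0 : ℝ)).is_linear_image (f := fun t : ℝ => t • d)
      ⟨fun a b => add_smul a b d, fun a b => mul_smul a b d⟩
    have h2 := this.translate x
    rwa [Set.image_image] at h2
  obtain ⟨f, u, hfu, huf⟩ := geometric_hahn_banach_open hconv.interior isOpen_interior hray (by
    rw [Set.disjoint_right]
    rintro _ ⟨t, ht, rfl⟩
    exact hcon t ht)
  have hle : ∀ y ∈ closure B, f y ≤ u := by
    intro y hy
    rw [← hconv.closure_interior_eq_closure_of_nonempty_interior hint] at hy
    exact closure_minimal (fun z hz => (hfu z hz).le)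
      (isClosed_le f.continuous continuous_const) hy
  have hge : ∀ t : ℝ, 0 < t → u ≤ f x + t * f d := fun t ht => by
    simpa using huf _ ⟨t, ht, rfl⟩
  have hux : u ≤ f x := by
    refine le_of_forall_pos_le_add fun e he => ?_
    have hp : 0 < |f d| + 1 := by positivity
    have h1 := hge (e / (|f d| + 1)) (by positivity)
    have h2 : e / (|f d| + 1) * f d ≤ e := by
      rw [div_mul_eq_mul_div, div_le_iff₀ hp]
      nlinarith [le_abs_self (f d)]
    linarith
  have hfx : f x = u := le_antisymm (hle x hx) hux
  have hf0 : f ≠ 0 := by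
    rintro rfl
    obtain ⟨c, hc⟩ := hint
    have := hfu c hc
    simp at this hfx
    linarith
  have hd := h f hf0 fun y hy => (hle y (subset_closure hy)).trans hux
  have := hge 1 one_pos
  linarith

/-- At a point of an unconditional set, the coordinates of a supporting functional have the same
signs as the coordinates of the point. -/
theorem mul_apply_single_nonneg {ι : Type*} [DecidableEq ι] {B : Set (ι → ℝ)}
    (hsym : ∀ x ∈ B, ∀ σ : Equiv.Perm ι, ∀ ε : ι → ℝ,
      (∀ i, ε i = 1 ∨ ε i = -1) → (fun i => ε i * x (σ i)) ∈ B)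
    {x : ι → ℝ} (hx : x ∈ B) {f : (ι → ℝ) →L[ℝ] ℝ} (hf : ∀ y ∈ B, f y ≤ f x) (k : ι) :
    0 ≤ f (Pi.single k 1) * x k := by
  have hy := hf _ (hsym x hx 1 (fun i => if i = k then -1 else 1) fun i => by
    by_cases h : i = k <;> simp [h])
  have he : (fun i => (if i = k then (-1 : ℝ) else 1) * x ((1 : Equiv.Perm ι) i)) =
      x + (-2 * x k) • Pi.single k (1 : ℝ) := by
    ext i
    by_cases h : i = k
    · subst h; simp; ring
    · simp [h]
  rw [he, map_add, map_smul, smul_eq_mul] at hy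
  linarith

/-- At a point of a `1`-symmetric set, the moduli of the coordinates of a supporting functional
are ordered as those of the point. -/
theorem abs_apply_single_le {ι : Type*} [DecidableEq ι] {B : Set (ι → ℝ)}
    (hsym : ∀ x ∈ B, ∀ σ : Equiv.Perm ι, ∀ ε : ι → ℝ,
      (∀ i, ε i = 1 ∨ ε i = -1) → (fun i => ε i * x (σ i)) ∈ B)
    {x : ι → ℝ} (hx : x ∈ B) {f : (ι → ℝ) →L[ℝ] ℝ} (hf : ∀ y ∈ B, f y ≤ f x) {i k : ι}
    (hik : |x i| < |x k|) : |f (Pi.single i 1)| ≤ |f (Pi.single k 1)| := by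
  have hne : i ≠ k := by rintro rfl; exact lt_irrefl _ hik
  have hsgn : ∀ a : ℝ, ∃ s : ℝ, (s = 1 ∨ s = -1) ∧ s * a = |a| := fun a => by
    rcases abs_choice a with h | h
    · exact ⟨1, Or.inl rfl, by rw [h, one_mul]⟩
    · exact ⟨-1, Or.inr rfl, by rw [h]; ring⟩
  obtain ⟨s, hs, hs'⟩ := hsgn (f (Pi.single i 1) * x k)
  obtain ⟨t, ht, ht'⟩ := hsgn (f (Pi.single k 1) * x i)
  have hy := hf _ (hsym x hx (Equiv.swap i k)
    (fun j => if j = i then s else if j = k then t else 1) fun j => by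
      by_cases h : j = i
      · simpa [h] using hs
      · by_cases h' : j = k
        · simpa [h', hne.symm] using ht
        · simp [h, h'])
  have he : (fun j => (if j = i then s else if j = k then t else 1) * x (Equiv.swap i k j)) =
      x + (s * x k - x i) • Pi.single i (1 : ℝ) + (t * x i - x k) • Pi.single k (1 : ℝ) := by
    ext j
    by_cases h : j = i
    · subst h; simp [hne]
    · by_cases h' : j = k
      · subst h'; simp [hne.symm]
      · simp [h, h', Equiv.swap_apply_of_ne_of_ne h h']
  rw [he, map_add, map_add, map_smul, map_smul, smul_eq_mul, smul_eq_mul] at hy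
  have hi := abs_of_nonneg (mul_apply_single_nonneg hsym hx hf i)
  have hk := abs_of_nonneg (mul_apply_single_nonneg hsym hx hf k)
  rw [abs_mul] at hs' ht' hi hk
  nlinarith

theorem mul_sign_eq_abs {a b : ℝ} (hb : b ≠ 0) (hab : 0 ≤ a * b) :
    a * Real.sign b = |a| := by
  rcases lt_or_gt_of_ne hb with h | h
  · rw [Real.sign_of_neg h, abs_of_nonpos (nonpos_of_mul_nonneg_left hab h)]
    ring
  · rw [Real.sign_of_pos h, abs_of_nonneg (nonneg_of_mul_nonneg_left hab h), mul_one]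


/-- Lemma (trickier deep illumination): let `n ≥ 3`, `B ∈ 𝒮ⁿ`, `x ∈ ∂B`, and let `k₀` be an
index of maximal `|x k₀|`. For `δ ∈ (0, 1/n)`, `x` is illuminated by any direction `d` with
`d k₀ = -sign (x k₀)`, `d k = -δ · sign (x k)` for every other index `k` of maximal modulus,
and `|d i| = δ` (arbitrary sign) for the remaining indices. -/
theorem stmt_8 {n : ℕ} (hn : 3 ≤ n) (B : Set (Fin n → ℝ))
    (hB_conv : Convex ℝ B) (hB_comp : IsCompact B) (hB_int : (interior B).Nonempty)
    (hB_sym : ∀ x ∈ B, ∀ σ : Equiv.Perm (Fin n), ∀ ε : Fin n → ℝ,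
      (∀ i, ε i = 1 ∨ ε i = -1) → (fun i => ε i * x (σ i)) ∈ B)
    (hB_norm : ∀ i : Fin n, (Pi.single i (1 : ℝ) : Fin n → ℝ) ∈ frontier B)
    (x : Fin n → ℝ) (hx : x ∈ frontier B) (k₀ : Fin n)
    (hk₀ : ∀ i, |x i| ≤ |x k₀|)
    (δ : ℝ) (hδ0 : 0 < δ) (hδn : δ < 1 / n)
    (d : Fin n → ℝ) (hdk₀ : d k₀ = -Real.sign (x k₀))
    (hdM : ∀ k, |x k| = |x k₀| → k ≠ k₀ → d k = -δ * Real.sign (x k))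
    (hdrest : ∀ i, |x i| ≠ |x k₀| → |d i| = δ) :
    ∃ ε : ℝ, 0 < ε ∧ x + ε • d ∈ interior B := by
  have hxB : x ∈ B := hB_comp.isClosed.frontier_subset hx
  refine exists_add_smul_mem_interior_of_normal hB_conv hB_int hx.1 fun f hf0 hf => ?_
  have hsum : ∀ y : Fin n → ℝ, f y = ∑ i, y i * f (Pi.single i 1) := fun y => by
    conv_lhs => rw [pi_eq_sum_univ' y]
    simp [map_sum]
  have hxk : x k₀ ≠ 0 := by
    intro h0
    have hx0 : x = 0 := by
      ext i
      have := hk₀ i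
      rw [h0, abs_zero] at this
      simpa using this
    refine hf0 (ContinuousLinearMap.ext fun y => ?_)
    have hB0 : ∀ y ∈ B, f y = 0 := fun y hy => by
      have h1 := hf y hy
      have h2 := hf _ (hB_sym y hy 1 (fun _ => -1) fun _ => Or.inr rfl)
      have h3 : (fun i => (-1 : ℝ) * y ((1 : Equiv.Perm (Fin n)) i)) = -y := by
        ext i; simp
      rw [h3, map_neg] at h2
      rw [hx0, map_zero] at h1 h2
      linarith
    have hker : interior B ⊆ (LinearMap.ker f.toLinearMap : Set (Fin n → ℝ)) :=
      fun y hy => hB0 y (interior_subset hy)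
    have htop := Submodule.eq_top_of_nonempty_interior' (LinearMap.ker f.toLinearMap)
      (hB_int.mono (interior_maximal hker isOpen_interior))
    have : y ∈ LinearMap.ker f.toLinearMap := htop ▸ Submodule.mem_top
    simpa using this
  have hterm₀ : d k₀ * f (Pi.single k₀ 1) = -|f (Pi.single k₀ 1)| := by
    rw [hdk₀, ← mul_sign_eq_abs hxk (mul_apply_single_nonneg hB_sym hxB hf k₀)]
    ring
  have htermM : ∀ k, |x k| = |x k₀| → k ≠ k₀ →
      d k * f (Pi.single k 1) = -δ * |f (Pi.single k 1)| := fun k hk hne => by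
    have hk0 : x k ≠ 0 := by rwa [← abs_ne_zero, hk, abs_ne_zero]
    rw [hdM k hk hne, ← mul_sign_eq_abs hk0 (mul_apply_single_nonneg hB_sym hxB hf k)]
    ring
  have hrest : ∀ i, |x i| ≠ |x k₀| → |f (Pi.single i 1)| ≤ |f (Pi.single k₀ 1)| :=
    fun i hi => abs_apply_single_le hB_sym hxB hf (lt_of_le_of_ne (hk₀ i) hi)
  rw [hsum d]
  by_cases ha : f (Pi.single k₀ 1) = 0
  · have hterm : ∀ i, d i * f (Pi.single i 1) = -δ * |f (Pi.single i 1)| := fun i => by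
      by_cases hi : |x i| = |x k₀|
      · by_cases hik : i = k₀
        · simp [hik, ha]
        · exact htermM i hi hik
      · have := hrest i hi
        rw [ha, abs_zero, abs_nonpos_iff] at this
        simp [this]
    obtain ⟨j, hj⟩ : ∃ j, f (Pi.single j 1) ≠ 0 := by
      by_contra! hall
      exact hf0 (ContinuousLinearMap.ext fun y => by simp [hsum y, hall])
    refine Finset.sum_neg' (fun i _ => ?_) ⟨j, Finset.mem_univ j, ?_⟩
    · rw [hterm]; nlinarith [abs_nonneg (f (Pi.single i 1))]
    · rw [hterm]; nlinarith [abs_pos.mpr hj]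
  · have hpos : 0 < |f (Pi.single k₀ 1)| := abs_pos.mpr ha
    have hterm : ∀ i ∈ Finset.univ.erase k₀,
        d i * f (Pi.single i 1) ≤ δ * |f (Pi.single k₀ 1)| := fun i hi => by
      by_cases hM : |x i| = |x k₀|
      · rw [htermM i hM (Finset.ne_of_mem_erase hi)]
        nlinarith [abs_nonneg (f (Pi.single i 1)), mul_pos hδ0 hpos]
      · calc d i * f (Pi.single i 1) ≤ |d i * f (Pi.single i 1)| := le_abs_self _
          _ = δ * |f (Pi.single i 1)| := by rw [abs_mul, hdrest i hM]
          _ ≤ δ * |f (Pi.single k₀ 1)| := mul_le_mul_of_nonneg_left (hrest i hM) hδ0.le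
    have hle := Finset.sum_le_card_nsmul _ _ _ hterm
    rw [← Finset.add_sum_erase _ _ (Finset.mem_univ k₀), hterm₀]
    rw [Finset.card_erase_of_mem (Finset.mem_univ k₀), Finset.card_univ, Fintype.card_fin,
      nsmul_eq_mul, Nat.cast_sub (by omega), Nat.cast_one] at hle
    have hn0 : (0 : ℝ) < n := by exact_mod_cast (by omega : 0 < n)
    rw [lt_div_iff₀ hn0] at hδn
    nlinarith [mul_pos hδ0 hpos, mul_pos (sub_pos.mpr hδn) hpos]
end

section
/- Let n ≥ 2 and δ ∈ (0,1). There exists a subset 𝓘ⁿ of Gⁿ(δ) with cardinality |𝓘ⁿ| = 2ⁿ such that every x ∈ ℝⁿ \ {0} is deep illuminated by 𝓘ⁿ: there is d ∈ 𝓘ⁿ with sign(d_i) = −sign(x_i) for every i with x_i ≠ 0, and the coordinate of d of absolute value 1 occurs at an index j with x_j ≠ 0. -/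
/-- There is a map from sign vectors to coordinates such that every face of the discrete cube
with a nonempty set `S` of fixed coordinates contains a vertex that is mapped into `S`. -/
theorem exists_coordinate_selector (n : ℕ) :
    ∃ f : (Fin (n + 1) → ℤˣ) → Fin (n + 1), ∀ S : Set (Fin (n + 1)), S.Nonempty →
      ∀ v : Fin (n + 1) → ℤˣ, ∃ w, (∀ i ∈ S, w i = v i) ∧ f w ∈ S := by
  induction n with
  | zero =>
    refine ⟨fun _ => 0, fun S ⟨i, hi⟩ v => ⟨v, fun _ _ => rfl, ?_⟩⟩
    rwa [Fin.fin_one_eq_zero i] at hi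
  | succ n ih =>
    obtain ⟨g, hg⟩ := ih
    refine ⟨fun v => if ∏ i, v i = 1 then 0 else (g (Fin.tail v)).succ, fun S hS v => ?_⟩
    by_cases h0 : (0 : Fin (n + 2)) ∈ S
    · by_cases hu : S = Set.univ
      · exact ⟨v, fun _ _ => rfl, by simp [hu]⟩
      obtain ⟨k, hk⟩ := (Set.ne_univ_iff_exists_notMem S).1 hu
      refine ⟨Function.update v k (∏ i ∈ Finset.univ \ {k}, v i), fun i hi => ?_, ?_⟩
      · exact Function.update_of_ne (fun h : i = k => hk (h ▸ hi)) _ _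
      · simp [Finset.prod_update_of_mem, Int.units_mul_self, h0]
    · have hT : (Fin.succ ⁻¹' S).Nonempty := by
        obtain ⟨i, hi⟩ := hS
        obtain ⟨j, rfl⟩ := Fin.exists_succ_eq.2 (fun h : i = 0 => h0 (h ▸ hi))
        exact ⟨j, hi⟩
      obtain ⟨w, hw, hgw⟩ := hg _ hT (Fin.tail v)
      refine ⟨Fin.cons (-∏ i, w i) w, fun i hi => ?_, ?_⟩
      · obtain ⟨j, rfl⟩ := Fin.exists_succ_eq.2 (fun h : i = 0 => h0 (h ▸ hi))
        exact hw j hi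
      · have hprod : ∏ i, (Fin.cons (-∏ i, w i) w : Fin (n + 2) → ℤˣ) i = -1 := by
          simp [Fin.prod_univ_succ, Int.units_mul_self]
        have hne : (-1 : ℤˣ) ≠ 1 := by decide
        simpa [hprod, hne] using hgw

theorem Real.sign_units_mul_of_pos (u : ℤˣ) {r : ℝ} (hr : 0 < r) :
    Real.sign (((u : ℤ) : ℝ) * r) = ((u : ℤ) : ℝ) := by
  obtain rfl | rfl := Int.units_eq_one_or u
  · simp [Real.sign_of_pos hr]
  · simp [Real.sign_of_pos hr, Real.sign_neg]

/-- Proposition: for `n ≥ 2` and `δ ∈ (0,1)` there is a subset `𝓘ⁿ ⊆ Gⁿ(δ)` of cardinality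
`2ⁿ` which deep illuminates every nonzero vector of `ℝⁿ`. -/
theorem stmt_9 {n : ℕ} (hn : 2 ≤ n) (δ : ℝ) (hδ : δ ∈ Set.Ioo (0 : ℝ) 1) :
    ∃ I : Finset (Fin n → ℝ),
      (∀ d ∈ I, ∃ i : Fin n, |d i| = 1 ∧ ∀ j, j ≠ i → |d j| = δ) ∧
      I.card = 2 ^ n ∧
      ∀ x : Fin n → ℝ, x ≠ 0 →
        ∃ d ∈ I, (∀ i, x i ≠ 0 → Real.sign (d i) = -Real.sign (x i)) ∧
          ∃ j, x j ≠ 0 ∧ |d j| = 1 := by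
  obtain ⟨n, rfl⟩ := Nat.exists_eq_succ_of_ne_zero (by omega : n ≠ 0)
  obtain ⟨f, hf⟩ := exists_coordinate_selector n
  let D : (Fin (n + 1) → ℤˣ) → Fin (n + 1) → ℝ :=
    fun s i => ((s i : ℤ) : ℝ) * if i = f s then 1 else δ
  have hsign (s i) : Real.sign (D s i) = ((s i : ℤ) : ℝ) := by
    refine Real.sign_units_mul_of_pos _ ?_
    split_ifs
    exacts [one_pos, hδ.1]
  have habs (s i) : |D s i| = if i = f s then 1 else δ := by
    obtain h | h := Int.units_eq_one_or (s i) <;> simp only [D, h] <;> split_ifs <;>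
      simp [abs_of_pos hδ.1]
  have hinj : Function.Injective D := fun s t h => by
    ext i
    have := hsign s i
    rw [h, hsign t i] at this
    exact_mod_cast this.symm
  refine ⟨Finset.univ.image D, ?_, ?_, fun x hx => ?_⟩
  · simp only [Finset.mem_image, Finset.mem_univ, true_and, forall_exists_index]
    rintro _ s rfl
    exact ⟨f s, by simp [habs], fun j hj => by simp [habs, hj]⟩
  · simp [Finset.card_image_of_injective _ hinj]
  · obtain ⟨w, hw, hfw⟩ := hf {i | x i ≠ 0} (Function.ne_iff.1 hx)
      (fun i => if 0 < x i then -1 else 1)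
    refine ⟨D w, Finset.mem_image_of_mem D (Finset.mem_univ w), fun i hi => ?_,
      f w, hfw, by simp [habs]⟩
    rw [hsign, hw i hi]
    obtain h | h := lt_or_gt_of_ne hi
    · simp [Real.sign_of_neg h, h.le.not_gt]
    · simp [Real.sign_of_pos h, h]
end

section
/- For every n ≥ 3 there exists a set 𝓘 ⊆ Gⁿ(1/(n+1)) with cardinality |𝓘| = 2ⁿ which illuminates every 1-symmetric convex body in ℝⁿ: for every 1-symmetric convex body B ⊆ ℝⁿ and every boundary point x of B, there exist d ∈ 𝓘 and ε > 0 with x + εd in the interior of B. In particular, every 1-symmetric convex body in ℝⁿ has illumination number at most 2ⁿ. -/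
open Finset in
/-- There is a choice of one coordinate for each vertex of the discrete cube such that every
subcube with a nonempty set `M` of fixed coordinates has a vertex whose chosen coordinate
lies in `M`. -/
lemma exists_coordinate_choice (n : ℕ) :
    ∃ π : (Fin (n + 1) → ZMod 2) → Fin (n + 1),
      ∀ M : Set (Fin (n + 1)), M.Nonempty → ∀ p : Fin (n + 1) → ZMod 2,
        ∃ t, (∀ i ∈ M, t i = p i) ∧ π t ∈ M := by
  induction n with
  | zero =>
    refine ⟨fun _ => 0, fun M ⟨i, hi⟩ p => ⟨p, fun _ _ => rfl, ?_⟩⟩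
    rwa [show i = 0 from Fin.ext (by omega)] at hi
  | succ n ih =>
    obtain ⟨ρ, hρ⟩ := ih
    refine ⟨fun s => if ∑ i, s i = 0 then 0 else (ρ (Fin.tail s)).succ, fun M hM p => ?_⟩
    by_cases h0 : (0 : Fin (n + 2)) ∈ M
    · by_cases hu : ∃ j, j ∉ M
      · obtain ⟨j, hj⟩ := hu
        refine ⟨p + Pi.single j (-∑ i, p i), fun i hi => ?_, ?_⟩
        · have hij : i ≠ j := fun h => hj (h ▸ hi)
          simp [hij]
        · have hsum : ∑ i, (p + Pi.single j (-∑ i, p i) : Fin (n + 1 + 1) → ZMod 2) i = 0 := by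
            simp only [Pi.add_apply, sum_add_distrib, sum_pi_single', mem_univ, if_true,
              add_neg_cancel]
          simpa only [hsum, if_true] using h0
      · push Not at hu
        exact ⟨p, fun _ _ => rfl, hu _⟩
    · obtain ⟨u, hu, hu'⟩ := hρ (Fin.succ ⁻¹' M) (by
        obtain ⟨i, hi⟩ := hM
        have hi0 : i ≠ 0 := fun h => h0 (h ▸ hi)
        exact ⟨i.pred hi0, by simpa using hi⟩) (Fin.tail p)
      refine ⟨Fin.cons (1 - ∑ i, u i) u, fun i hi => ?_, ?_⟩
      · have hi0 : i ≠ 0 := fun h => h0 (h ▸ hi)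
        obtain ⟨k, rfl⟩ := Fin.exists_succ_eq.2 hi0
        simpa [Fin.tail] using hu k hi
      · simpa [Fin.sum_univ_succ] using hu'

/-- A boundary point of a convex set which is not illuminated by `d` has a supporting
functional which is nonnegative at `d`. -/
lemma exists_supporting_of_not_illuminates {E : Type*} [NormedAddCommGroup E] [NormedSpace ℝ E]
    {B : Set E} (hB : Convex ℝ B) (hint : (interior B).Nonempty) {x d : E}
    (hx : x ∈ frontier B) (h : ∀ ε : ℝ, 0 < ε → x + ε • d ∉ interior B) :
    ∃ f : StrongDual ℝ E, (∀ b ∈ interior B, f b < f x) ∧ (∀ b ∈ B, f b ≤ f x) ∧ 0 ≤ f d := by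
  have hray : Convex ℝ ((fun ε : ℝ => x + ε • d) '' Set.Ioi 0) := by
    have := (((convex_Ioi (0 : ℝ)).is_linear_image (f := fun ε : ℝ => ε • d)
      (IsLinearMap.isLinearMap_smul' d)).translate x)
    rwa [Set.image_image] at this
  obtain ⟨f, u, hfu, huf⟩ := geometric_hahn_banach_open hB.interior isOpen_interior hray (by
    rw [Set.disjoint_right]
    rintro _ ⟨ε, hε, rfl⟩
    exact h ε hε)
  have hcl : ∀ b ∈ closure B, f b ≤ u := by
    intro b hb
    rw [← hB.closure_interior_eq_closure_of_nonempty_interior hint] at hb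
    exact closure_minimal (fun y hy => (hfu y hy).le)
      (isClosed_le f.continuous continuous_const) hb
  have hray' : ∀ ε : ℝ, 0 < ε → u ≤ f x + ε * f d := fun ε hε => by
    simpa using huf _ ⟨ε, hε, rfl⟩
  have hxu : f x = u := by
    refine le_antisymm (hcl x hx.1) (le_of_forall_pos_le_add fun η hη => ?_)
    have hpos : 0 < |f d| + 1 := by positivity
    have h1 := hray' (η / (|f d| + 1)) (by positivity)
    have h2 : η / (|f d| + 1) * f d ≤ η := by
      rw [div_mul_eq_mul_div, div_le_iff₀ hpos]
      nlinarith [le_abs_self (f d)]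
    linarith
  refine ⟨f, fun b hb => hxu ▸ hfu b hb, fun b hb => hxu ▸ hcl b (subset_closure hb), ?_⟩
  have := hray' 1 one_pos
  linarith

/-- The absolute coefficients of a supporting functional of a 1-symmetric set at `x` align with
the coordinates of `x`. -/
lemma supporting_coefficients {n : ℕ} {B : Set (Fin n → ℝ)}
    (hsymm : ∀ x ∈ B, ∀ σ : Equiv.Perm (Fin n), ∀ ε : Fin n → ℝ,
      (∀ i, ε i = 1 ∨ ε i = -1) → (fun i => ε i * x (σ i)) ∈ B)
    {c x : Fin n → ℝ} (hxB : x ∈ B) (hsup : ∀ b ∈ B, ∑ i, c i * b i ≤ ∑ i, c i * x i) :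
    (∀ i, c i * x i = |c i| * |x i|) ∧ ∀ i j, |x j| < |x i| → |c j| ≤ |c i| := by
  have hperm : ∀ σ : Equiv.Perm (Fin n), ∑ i, |c i| * |x (σ i)| ≤ ∑ i, c i * x i := by
    intro σ
    refine le_trans (le_of_eq ?_) (hsup _ (hsymm x hxB σ
      (fun i => if 0 ≤ c i * x (σ i) then 1 else -1) fun i => by
        by_cases h : 0 ≤ c i * x (σ i) <;> simp [h]))
    refine Finset.sum_congr rfl fun i _ => ?_
    rw [← abs_mul]
    split_ifs with h
    · rw [abs_of_nonneg h]; ring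
    · rw [abs_of_neg (not_le.1 h)]; ring
  have hle : ∀ i ∈ Finset.univ, c i * x i ≤ |c i| * |x i| := fun i _ => by
    rw [← abs_mul]; exact le_abs_self _
  have heq : ∀ i, c i * x i = |c i| * |x i| := fun i =>
    (Finset.sum_eq_sum_iff_of_le hle).1
      (le_antisymm (Finset.sum_le_sum hle) (by simpa using hperm 1)) i (Finset.mem_univ i)
  refine ⟨heq, fun i j hij => ?_⟩
  have hne : i ≠ j := by rintro rfl; exact lt_irrefl _ hij
  have h := hperm (Equiv.swap i j)
  rw [← sub_nonneg, ← Finset.sum_sub_distrib] at h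
  have hsplit : ∑ k, (c k * x k - |c k| * |x (Equiv.swap i j k)|) =
      (|c i| - |c j|) * (|x i| - |x j|) := by
    rw [← Finset.sum_subset (Finset.subset_univ {i, j}), Finset.sum_pair hne,
      heq, heq, Equiv.swap_apply_left, Equiv.swap_apply_right]
    · ring
    · intro k _ hk
      simp only [Finset.mem_insert, Finset.mem_singleton, not_or] at hk
      rw [Equiv.swap_apply_of_ne_of_ne hk.1 hk.2, heq, sub_self]
  rw [hsplit] at h
  exact sub_nonneg.1 (nonneg_of_mul_nonneg_left h (sub_pos.2 hij))

/-- A sum with one dominant coordinate `m` among the coordinates in `M`, and with nonpositive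
terms on `M`, is negative. -/
lemma sum_mul_neg_of_dominant {n : ℕ} {c d : Fin n → ℝ} {M : Set (Fin n)} {m : Fin n}
    (hm : m ∈ M) (hdm : |d m| = 1) (hd : ∀ j, j ≠ m → |d j| = 1 / ((n : ℝ) + 1))
    (hM : ∀ i ∈ M, c i * d i = -(|c i| * |d i|)) (hc : ∀ i ∉ M, |c i| ≤ |c m|) (hc0 : c ≠ 0) :
    ∑ i, c i * d i < 0 := by
  by_contra! hsum
  have hn : (0 : ℝ) < n + 1 := by positivity
  have hnn : 1 ≤ n := Fin.pos m
  have hbound : ∀ i ∈ Finset.univ.erase m, c i * d i ≤ |c m| * (1 / ((n : ℝ) + 1)) := by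
    intro i hi
    by_cases hiM : i ∈ M
    · rw [hM i hiM]
      have h1 : 0 ≤ |c i| * |d i| := by positivity
      have h2 : 0 ≤ |c m| * (1 / ((n : ℝ) + 1)) := by positivity
      linarith
    · refine (le_abs_self _).trans ?_
      rw [abs_mul, hd i (Finset.ne_of_mem_erase hi)]
      exact mul_le_mul_of_nonneg_right (hc i hiM) (by positivity)
  have hcm : c m = 0 := by
    have h := Finset.sum_le_card_nsmul _ _ _ hbound
    rw [Finset.card_erase_of_mem (Finset.mem_univ m), Finset.card_univ, Fintype.card_fin,
      nsmul_eq_mul, Nat.cast_sub hnn, Nat.cast_one] at h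
    rw [← Finset.add_sum_erase _ _ (Finset.mem_univ m), hM m hm, hdm] at hsum
    have h3 : |c m| ≤ ((n : ℝ) - 1) * (|c m| * (1 / ((n : ℝ) + 1))) := by linarith
    have h4 : ((n : ℝ) - 1) * (|c m| * (1 / ((n : ℝ) + 1))) = ((n : ℝ) - 1) * |c m| / (n + 1) := by
      ring
    rw [h4, le_div_iff₀ hn] at h3
    have h5 : |c m| ≤ 0 := by linarith
    exact abs_nonpos_iff.1 h5
  have hc' : ∀ i ∉ M, c i = 0 := fun i hi => abs_nonpos_iff.1 (by simpa [hcm] using hc i hi)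
  have hnonpos : ∀ i ∈ Finset.univ, c i * d i ≤ 0 := fun i _ => by
    by_cases hi : i ∈ M
    · rw [hM i hi]
      exact neg_nonpos.2 (by positivity)
    · simp [hc' i hi]
  have hzero := (Finset.sum_eq_zero_iff_of_nonpos hnonpos).1
    (le_antisymm (Finset.sum_nonpos hnonpos) hsum)
  refine hc0 (funext fun i => ?_)
  have hdi : d i ≠ 0 := abs_pos.1 (by
    rcases eq_or_ne i m with rfl | hi
    · rw [hdm]; exact one_pos
    · rw [hd i hi]; positivity)
  exact (mul_eq_zero.1 (hzero i (Finset.mem_univ i))).resolve_right hdi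

/-- A convex set with nonempty interior which is invariant under negation has the origin in its
interior. -/
lemma zero_mem_interior_of_neg_mem {E : Type*} [NormedAddCommGroup E] [NormedSpace ℝ E]
    {B : Set E} (hB : Convex ℝ B) (hint : (interior B).Nonempty) (hneg : ∀ x ∈ B, -x ∈ B) :
    (0 : E) ∈ interior B := by
  obtain ⟨y, hy⟩ := hint
  have := hB.combo_interior_self_mem_interior hy (hneg y (interior_subset hy))
    (a := 1 / 2) (b := 1 / 2) (by norm_num) (by norm_num) (by norm_num)
  simpa using this

/-- A direction illuminates `x` if its dominant coordinate is one at which `|x|` is maximal, and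
if it points inwards at all such coordinates. -/
lemma illuminates_of_dominant {n : ℕ} {B : Set (Fin n → ℝ)} (hB : Convex ℝ B)
    (hcl : IsClosed B) (hint : (interior B).Nonempty)
    (hsymm : ∀ x ∈ B, ∀ σ : Equiv.Perm (Fin n), ∀ ε : Fin n → ℝ,
      (∀ i, ε i = 1 ∨ ε i = -1) → (fun i => ε i * x (σ i)) ∈ B)
    {x d : Fin n → ℝ} (hx : x ∈ frontier B) {m : Fin n} (hm : ∀ j, |x j| ≤ |x m|)
    (hdm : |d m| = 1) (hd : ∀ j, j ≠ m → |d j| = 1 / ((n : ℝ) + 1))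
    (hsign : ∀ i, (∀ j, |x j| ≤ |x i|) → x i * d i = -(|x i| * |d i|)) :
    ∃ ε : ℝ, 0 < ε ∧ x + ε • d ∈ interior B := by
  by_contra! hno
  obtain ⟨f, hfint, hfB, hfd⟩ := exists_supporting_of_not_illuminates hB hint hx hno
  have hxB : x ∈ B := hcl.frontier_subset hx
  have h0 : (0 : Fin n → ℝ) ∈ interior B := by
    refine zero_mem_interior_of_neg_mem hB hint fun y hy => ?_
    convert hsymm y hy 1 (fun _ => -1) (fun _ => Or.inr rfl) using 1
    ext i
    simp
  have hfx : 0 < f x := by simpa using hfint 0 h0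
  set c : Fin n → ℝ := fun i => f (Pi.single i 1) with hc
  have hf : ∀ y, f y = ∑ i, c i * y i := fun y => by
    conv_lhs => rw [pi_eq_sum_univ' y]
    rw [map_sum]
    refine Finset.sum_congr rfl fun i _ => ?_
    rw [map_smul, smul_eq_mul, mul_comm, hc]
  obtain ⟨halign, hmono⟩ := supporting_coefficients hsymm (c := c) hxB
    (fun b hb => by rw [← hf, ← hf]; exact hfB b hb)
  have hc0 : c ≠ 0 := fun h => by simp [hf, h] at hfx
  have hxm : 0 < |x m| := by
    refine lt_of_le_of_ne (abs_nonneg _) fun h => ?_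
    have hx0 : x = 0 := funext fun j => abs_nonpos_iff.1 ((hm j).trans_eq h.symm)
    simp [hx0] at hfx
  refine (hfd.trans_eq (hf d)).not_gt (sum_mul_neg_of_dominant (M := {i | ∀ j, |x j| ≤ |x i|})
    hm hdm hd (fun i hi => ?_) (fun i hi => ?_) hc0)
  · have hxi : 0 < |x i| := hxm.trans_le (hi m)
    have h1 := halign i
    have h2 := hsign i hi
    have h3 : |x i| * |x i| * (c i * d i) = |x i| * |x i| * -(|c i| * |d i|) := by
      calc |x i| * |x i| * (c i * d i) = (c i * x i) * (x i * d i) := by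
            rw [abs_mul_abs_self]; ring
        _ = |x i| * |x i| * -(|c i| * |d i|) := by rw [h1, h2]; ring
    exact mul_left_cancel₀ (by positivity) h3
  · simp only [Set.mem_ofPred_eq, not_forall, not_le] at hi
    obtain ⟨j, hj⟩ := hi
    exact hmono m i (hj.trans_le (hm j))

/-- Theorem D: for every `n ≥ 3` there is a subset of `Gⁿ(1/(n+1))` of cardinality `2ⁿ`
which illuminates every 1-symmetric convex body in `ℝⁿ`; in particular every 1-symmetric
convex body has illumination number at most `2ⁿ`. -/
theorem stmt_10 {n : ℕ} (hn : 3 ≤ n) :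
    ∃ I : Finset (Fin n → ℝ),
      (∀ d ∈ I, ∃ i : Fin n, |d i| = 1 ∧ ∀ j, j ≠ i → |d j| = 1 / ((n : ℝ) + 1)) ∧
      I.card = 2 ^ n ∧
      ∀ B : Set (Fin n → ℝ), Convex ℝ B → IsCompact B → (interior B).Nonempty →
        (∀ x ∈ B, ∀ σ : Equiv.Perm (Fin n), ∀ ε : Fin n → ℝ,
          (∀ i, ε i = 1 ∨ ε i = -1) → (fun i => ε i * x (σ i)) ∈ B) →
        ∀ x ∈ frontier B, ∃ d ∈ I, ∃ ε : ℝ, 0 < ε ∧ x + ε • d ∈ interior B := by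
  obtain ⟨k, rfl⟩ : ∃ k, n = k + 1 := ⟨n - 1, by omega⟩
  obtain ⟨π, hπ⟩ := exists_coordinate_choice k
  set w : (Fin (k + 1) → ZMod 2) → Fin (k + 1) → ℝ :=
    fun s i => if i = π s then 1 else 1 / (((k + 1 : ℕ) : ℝ) + 1) with hw
  have hwpos : ∀ s i, 0 < w s i := fun s i => by
    simp only [hw]
    split_ifs <;> positivity
  set D : (Fin (k + 1) → ZMod 2) → Fin (k + 1) → ℝ :=
    fun s i => if s i = 0 then w s i else -w s i with hD
  have habs : ∀ s i, |D s i| = w s i := fun s i => by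
    simp only [hD]
    split_ifs
    · exact abs_of_pos (hwpos s i)
    · rw [abs_neg, abs_of_pos (hwpos s i)]
  have hDpos : ∀ s i, 0 < D s i ↔ s i = 0 := fun s i => by
    simp only [hD]
    split_ifs with h
    · simp [h, hwpos s i]
    · simp [h, (hwpos s i).le]
  have hinj : Function.Injective D := fun s t hst => by
    ext1 i
    have h : s i = 0 ↔ t i = 0 := by rw [← hDpos, ← hDpos, hst]
    revert h
    generalize s i = a
    generalize t i = b
    revert a b
    decide
  have hDm : ∀ s, |D s (π s)| = 1 := fun s => by rw [habs]; simp [hw]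
  have hDo : ∀ s j, j ≠ π s → |D s j| = 1 / (((k + 1 : ℕ) : ℝ) + 1) := fun s j hj => by
    rw [habs]; simp only [hw, if_neg hj]
  refine ⟨Finset.univ.map ⟨D, hinj⟩, fun d hd => ?_, ?_, ?_⟩
  · obtain ⟨s, -, rfl⟩ := Finset.mem_map.1 hd
    exact ⟨π s, hDm s, hDo s⟩
  · simp [ZMod.card]
  · intro B hB hcomp hint hsymm x hx
    obtain ⟨m, hm⟩ := Finite.exists_max fun i => |x i|
    obtain ⟨t, ht, htM⟩ := hπ {i | ∀ j, |x j| ≤ |x i|} ⟨m, hm⟩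
      (fun i => if x i ≤ 0 then 0 else 1)
    refine ⟨D t, Finset.mem_map_of_mem ⟨D, hinj⟩ (Finset.mem_univ t),
      illuminates_of_dominant hB hcomp.isClosed hint hsymm hx htM (hDm t) (hDo t) fun i hi => ?_⟩
    rw [habs]
    simp only [hD, ht i hi]
    by_cases h : x i ≤ 0
    · simp [h, abs_of_nonpos h]
    · simp [h, abs_of_pos (not_le.1 h)]
end

section
/- Let n ≥ 3 and let B be a 1-symmetric convex body in ℝⁿ with each standard basis vector e_i on its boundary, such that e_i + e_j ∉ B for all 1 ≤ i < j ≤ n. Then B can be illuminated by a set of directions of cardinality 2^{n−1} + 2; consequently, the illumination number of B is at most 2^{n−1} + 2. -/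
open Finset in
/-- A linear functional bounded above on a 1-symmetric set is bounded on all rearrangements of a
point, even after passing to absolute values. -/
theorem sum_abs_mul_abs_perm_le {n : ℕ} {B : Set (Fin n → ℝ)}
    (hB_sym : ∀ x ∈ B, ∀ σ : Equiv.Perm (Fin n), ∀ ε : Fin n → ℝ,
      (∀ i, ε i = 1 ∨ ε i = -1) → (fun i => ε i * x (σ i)) ∈ B)
    {a x : Fin n → ℝ} {M : ℝ} (hx : x ∈ B) (ha : ∀ b ∈ B, ∑ i, a i * b i ≤ M)
    (σ : Equiv.Perm (Fin n)) : ∑ i, |a i| * |x (σ i)| ≤ M := by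
  have h := ha _ (hB_sym x hx σ (fun i => if 0 ≤ a i * x (σ i) then 1 else -1)
    (fun i => by by_cases h : 0 ≤ a i * x (σ i) <;> simp [h]))
  refine le_of_eq_of_le (sum_congr rfl fun i _ => ?_) h
  rw [← abs_mul]
  by_cases h : 0 ≤ a i * x (σ i)
  · simp [h, abs_of_nonneg]
  · simp [h, abs_of_neg (not_le.mp h)]

theorem apply_eq_sum_apply_single_mul {n : ℕ} (φ : StrongDual ℝ (Fin n → ℝ)) (y : Fin n → ℝ) :
    φ y = ∑ i, φ (Pi.single i 1) * y i := by
  conv_lhs => rw [← Finset.univ_sum_single y, map_sum]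
  refine Finset.sum_congr rfl fun i _ => ?_
  rw [mul_comm, ← smul_eq_mul, ← map_smul, ← Pi.single_smul', smul_eq_mul, mul_one]

/-- A direction on which every supporting functional at `x` is negative illuminates `x`. -/
theorem exists_add_smul_mem_interior {n : ℕ} {B : Set (Fin n → ℝ)} (hB_conv : Convex ℝ B)
    (hB_int : (interior B).Nonempty) {x d : Fin n → ℝ} (hx : x ∈ B)
    (h : ∀ a : Fin n → ℝ, a ≠ 0 → (∀ b ∈ B, ∑ i, a i * b i ≤ ∑ i, a i * x i) →
      ∑ i, a i * d i < 0) :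
    ∃ ε : ℝ, 0 < ε ∧ x + ε • d ∈ interior B := by
  by_contra! hcon
  have hconv : Convex ℝ ((fun ε : ℝ => x + ε • d) '' Set.Ioi 0) := by
    have h := (convex_Ioi (0 : ℝ)).affine_image (AffineMap.lineMap x (x + d))
    refine (Set.image_congr fun ε _ => ?_) ▸ h
    simp [AffineMap.lineMap_apply, add_comm]
  obtain ⟨φ, u, hφ, hu⟩ := geometric_hahn_banach_open hB_conv.interior isOpen_interior hconv (by
    rw [Set.disjoint_right]
    rintro _ ⟨ε, hε, rfl⟩
    exact hcon ε hε)
  have hu' : ∀ ε : ℝ, 0 < ε → u ≤ φ x + ε * φ d := fun ε hε => by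
    simpa using hu _ ⟨ε, hε, rfl⟩
  have hBu : ∀ b ∈ B, φ b ≤ u := by
    intro b hb
    have hcl : b ∈ closure (interior B) := by
      rw [hB_conv.closure_interior_eq_closure_of_nonempty_interior hB_int]
      exact subset_closure hb
    have : closure (interior B) ⊆ {y | φ y ≤ u} :=
      closure_minimal (fun y hy => (hφ y hy).le) (isClosed_le φ.continuous continuous_const)
    exact this hcl
  have hux : u ≤ φ x := by
    have ht : Filter.Tendsto (fun ε : ℝ => φ x + ε * φ d) (nhdsWithin 0 (Set.Ioi 0))
        (nhds (φ x)) := by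
      have : Continuous fun ε : ℝ => φ x + ε * φ d := by fun_prop
      simpa using (this.tendsto 0).mono_left nhdsWithin_le_nhds
    exact ge_of_tendsto ht (by filter_upwards [self_mem_nhdsWithin] with ε hε using hu' ε hε)
  have hrep := apply_eq_sum_apply_single_mul φ
  have hd := h (fun i => φ (Pi.single i 1)) (by
    intro h0
    obtain ⟨y, hy⟩ := hB_int
    have hz : ∀ z, φ z = 0 := fun z => by
      rw [hrep]
      exact Finset.sum_eq_zero fun i _ => by rw [congrFun h0 i]; simp
    have h1 := hφ y hy
    have h2 := hu' 1 one_pos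
    simp only [hz] at h1 h2
    linarith) (fun b hb => by
      rw [← hrep, ← hrep]
      exact (hBu b hb).trans hux)
  rw [← hrep] at hd
  have := hu' 1 one_pos
  have := hBu x hx
  linarith

/-- In a closed convex 1-symmetric set without `e i + e j`, no point has two coordinates of absolute
value at least one. -/
theorem abs_lt_one_of_single_add_single_notMem {n : ℕ} {B : Set (Fin n → ℝ)}
    (hB_conv : Convex ℝ B) (hB_closed : IsClosed B)
    (hB_sym : ∀ x ∈ B, ∀ σ : Equiv.Perm (Fin n), ∀ ε : Fin n → ℝ,
      (∀ i, ε i = 1 ∨ ε i = -1) → (fun i => ε i * x (σ i)) ∈ B)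
    {i j : Fin n} (hij : i ≠ j)
    (hno : (Pi.single i (1 : ℝ) + Pi.single j (1 : ℝ) : Fin n → ℝ) ∉ B)
    {x : Fin n → ℝ} (hx : x ∈ B) (hi : 1 ≤ |x i|) : |x j| < 1 := by
  by_contra! hj
  obtain ⟨φ, u, hφ, hu⟩ := geometric_hahn_banach_closed_point hB_conv hB_closed hno
  have hrep := apply_eq_sum_apply_single_mul φ
  have h := sum_abs_mul_abs_perm_le hB_sym (a := fun i => φ (Pi.single i 1)) (M := u) hx
    (fun b hb => by rw [← hrep]; exact (hφ b hb).le) 1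
  have h2 := Finset.sum_le_sum_of_subset_of_nonneg (Finset.subset_univ {i, j})
    (f := fun k => |φ (Pi.single k 1)| * |x k|) (fun k _ _ => by positivity)
  rw [Finset.sum_pair hij] at h2
  simp only [Equiv.Perm.coe_one, id] at h
  rw [map_add] at hu
  have h3 := le_abs_self (φ (Pi.single i 1))
  have h4 := le_abs_self (φ (Pi.single j 1))
  have h5 := le_mul_of_one_le_right (abs_nonneg (φ (Pi.single i 1))) hi
  have h6 := le_mul_of_one_le_right (abs_nonneg (φ (Pi.single j 1))) hj
  linarith

section Supporting

variable {n : ℕ} {B : Set (Fin n → ℝ)} {a x : Fin n → ℝ}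

theorem mul_eq_abs_mul_abs_of_supporting
    (hB_sym : ∀ x ∈ B, ∀ σ : Equiv.Perm (Fin n), ∀ ε : Fin n → ℝ,
      (∀ i, ε i = 1 ∨ ε i = -1) → (fun i => ε i * x (σ i)) ∈ B)
    (hx : x ∈ B) (ha : ∀ b ∈ B, ∑ i, a i * b i ≤ ∑ i, a i * x i) (i : Fin n) :
    a i * x i = |a i| * |x i| := by
  have hle : ∀ i ∈ Finset.univ, a i * x i ≤ |a i| * |x i| := fun i _ => by
    rw [← abs_mul]; exact le_abs_self _
  have h := sum_abs_mul_abs_perm_le hB_sym hx ha 1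
  exact (Finset.sum_eq_sum_iff_of_le hle).mp (le_antisymm (Finset.sum_le_sum hle) h) i
    (Finset.mem_univ i)

theorem abs_le_abs_of_supporting
    (hB_sym : ∀ x ∈ B, ∀ σ : Equiv.Perm (Fin n), ∀ ε : Fin n → ℝ,
      (∀ i, ε i = 1 ∨ ε i = -1) → (fun i => ε i * x (σ i)) ∈ B)
    (hx : x ∈ B) (ha : ∀ b ∈ B, ∑ i, a i * b i ≤ ∑ i, a i * x i) {i j : Fin n}
    (hij : |x j| < |x i|) : |a j| ≤ |a i| := by
  have hne : i ≠ j := by rintro rfl; exact lt_irrefl _ hij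
  have h := sum_abs_mul_abs_perm_le hB_sym hx ha (Equiv.swap i j)
  rw [Finset.sum_congr rfl fun i _ => mul_eq_abs_mul_abs_of_supporting hB_sym hx ha i,
    ← sub_nonneg, ← Finset.sum_sub_distrib,
    ← Finset.sum_subset (Finset.subset_univ {i, j}), Finset.sum_pair hne] at h
  · simp only [Equiv.swap_apply_left, Equiv.swap_apply_right] at h
    by_contra! hlt
    nlinarith [mul_pos (sub_pos.mpr hij) (sub_pos.mpr hlt)]
  · intro k _ hk
    simp only [Finset.mem_insert, Finset.mem_singleton, not_or] at hk
    rw [Equiv.swap_apply_of_ne_of_ne hk.1 hk.2, sub_self]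

theorem abs_le_sum_of_supporting
    (hB_sym : ∀ x ∈ B, ∀ σ : Equiv.Perm (Fin n), ∀ ε : Fin n → ℝ,
      (∀ i, ε i = 1 ∨ ε i = -1) → (fun i => ε i * x (σ i)) ∈ B)
    (ha : ∀ b ∈ B, ∑ i, a i * b i ≤ ∑ i, a i * x i) {i : Fin n}
    (hi : (Pi.single i (1 : ℝ) : Fin n → ℝ) ∈ B) : |a i| ≤ ∑ i, a i * x i := by
  have h := sum_abs_mul_abs_perm_le hB_sym hi ha 1
  rw [Finset.sum_eq_single i (fun j _ hj => by simp [hj]) (by simp)] at h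
  simpa using h

end Supporting

/-- Every sign pattern with nonempty domain `Tᶜ` and positive set `P` extends to a full one whose
number of positive entries, modulo `m`, is a position in `Tᶜ`. -/
theorem exists_finset_card_mod_notMem {m : ℕ} [NeZero m] (P T : Finset (Fin m))
    (hPT : Disjoint P T) (hT : T.card < m) :
    ∃ R ⊆ T, Fin.ofNat m (P ∪ R).card ∉ T := by
  have hinj : Set.InjOn (fun r => Fin.ofNat m (P.card + r)) (Finset.range (T.card + 1)) := by
    intro r hr r' hr' h
    simp only [Finset.coe_range, Set.mem_Iio] at hr hr'
    have h' : P.card + r ≡ P.card + r' [MOD m] := congrArg Fin.val h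
    have h'' := Nat.ModEq.add_left_cancel' _ h'
    exact Nat.ModEq.eq_of_lt_of_lt h'' (by omega) (by omega)
  have hcard : T.card < ((Finset.range (T.card + 1)).image fun r => Fin.ofNat m (P.card + r)).card := by
    rw [Finset.card_image_of_injOn hinj, Finset.card_range]
    exact Nat.lt_succ_self _
  obtain ⟨k, hk, hkT⟩ := Finset.exists_mem_notMem_of_card_lt_card hcard
  obtain ⟨r, hr, rfl⟩ := Finset.mem_image.mp hk
  obtain ⟨R, hRT, rfl⟩ := Finset.exists_subset_card_eq (Nat.lt_succ_iff.mp (Finset.mem_range.mp hr))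
  exact ⟨R, hRT, by rwa [Finset.card_union_of_disjoint (hPT.mono_right hRT)]⟩

/-- The direction with first coordinate zero whose other coordinates are negative exactly on `P`, and
whose largest coordinate is at position `P.card` modulo `m`. -/
def dominatedSignVector {m : ℕ} [NeZero m] (P : Finset (Fin m)) : Fin (m + 1) → ℝ :=
  Fin.cons 0 fun k => (if k ∈ P then -1 else 1) * (if k = Fin.ofNat m P.card then (m : ℝ) else 1)

/-- The pairing with `dominatedSignVector P` is negative on vectors whose sign pattern on `Tᶜ` is
given by `P` and whose entries on `T` are dominated by those on `Tᶜ`. -/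
theorem sum_mul_dominatedSignVector_neg {m : ℕ} [NeZero m] {P T : Finset (Fin m)}
    (hP : Fin.ofNat m P.card ∉ T) {a : Fin (m + 1) → ℝ} (ha : ∃ k : Fin m, a k.succ ≠ 0)
    (hpos : ∀ k ∉ T, k ∈ P → 0 ≤ a k.succ) (hneg : ∀ k ∉ T, k ∉ P → a k.succ ≤ 0)
    (hT : ∀ k ∈ T, ∀ l ∉ T, |a k.succ| ≤ |a l.succ|) :
    ∑ i, a i * dominatedSignVector P i < 0 := by
  have hm : (1 : ℝ) ≤ m := by exact_mod_cast Nat.one_le_iff_ne_zero.mpr (NeZero.ne m)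
  rw [Fin.sum_univ_succ]
  simp only [dominatedSignVector, Fin.cons_zero, mul_zero, zero_add, Fin.cons_succ]
  set f := Fin.ofNat m P.card
  have hS : ∀ k ∉ T, a k.succ * ((if k ∈ P then -1 else 1) * (if k = f then (m : ℝ) else 1)) =
      -(|a k.succ| * (if k = f then (m : ℝ) else 1)) := by
    intro k hk
    by_cases hkP : k ∈ P
    · rw [if_pos hkP, abs_of_nonneg (hpos k hk hkP)]; ring
    · rw [if_neg hkP, abs_of_nonpos (hneg k hk hkP)]; ring
  by_cases hf : a f.succ = 0
  · have hT0 : ∀ k ∈ T, a k.succ = 0 := fun k hk => by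
      simpa [hf] using hT k hk f hP
    have hw : ∀ k, (0 : ℝ) < if k = f then (m : ℝ) else 1 := fun k => by
      split_ifs <;> linarith
    have hle : ∀ k, a k.succ * ((if k ∈ P then -1 else 1) * (if k = f then (m : ℝ) else 1)) =
        -(|a k.succ| * (if k = f then (m : ℝ) else 1)) := fun k => by
      by_cases hk : k ∈ T
      · simp [hT0 k hk]
      · exact hS k hk
    obtain ⟨k, hk⟩ := ha
    rw [Finset.sum_congr rfl fun k _ => hle k]
    exact Finset.sum_neg' (fun k _ => neg_nonpos.mpr (mul_nonneg (abs_nonneg _) (hw k).le))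
      ⟨k, Finset.mem_univ k, neg_neg_of_pos (mul_pos (abs_pos.mpr hk) (hw k))⟩
  · have hf' := abs_pos.mpr hf
    rw [← Finset.add_sum_erase _ _ (Finset.mem_univ f), hS f hP, if_pos rfl]
    have hle : ∀ k ∈ Finset.univ.erase f,
        a k.succ * ((if k ∈ P then -1 else 1) * (if k = f then (m : ℝ) else 1)) ≤ |a f.succ| := by
      intro k hk
      by_cases hkT : k ∈ T
      · refine le_trans ?_ (hT k hkT f hP)
        rw [if_neg (Finset.ne_of_mem_erase hk)]
        split_ifs
        · simpa using neg_le_abs (a k.succ)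
        · simpa using le_abs_self (a k.succ)
      · rw [hS k hkT, if_neg (Finset.ne_of_mem_erase hk)]
        linarith [abs_nonneg (a k.succ)]
    have h := Finset.sum_le_card_nsmul _ _ _ hle
    rw [Finset.card_erase_of_mem (Finset.mem_univ f), Finset.card_univ, Fintype.card_fin,
      nsmul_eq_mul, Nat.cast_sub (by exact_mod_cast hm)] at h
    push_cast at h
    linarith

/-- Theorem: for `n ≥ 3`, a body `B ∈ 𝒮ⁿ` with `e i + e j ∉ B` for all `i < j` can be
illuminated by a set of `2^(n-1) + 2` directions, so `𝔍(B) ≤ 2^(n-1) + 2`. -/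
theorem stmt_11 {n : ℕ} (hn : 3 ≤ n) (B : Set (Fin n → ℝ))
    (hB_conv : Convex ℝ B) (hB_comp : IsCompact B) (hB_int : (interior B).Nonempty)
    (hB_sym : ∀ x ∈ B, ∀ σ : Equiv.Perm (Fin n), ∀ ε : Fin n → ℝ,
      (∀ i, ε i = 1 ∨ ε i = -1) → (fun i => ε i * x (σ i)) ∈ B)
    (hB_norm : ∀ i : Fin n, (Pi.single i (1 : ℝ) : Fin n → ℝ) ∈ frontier B)
    (hno2 : ∀ i j : Fin n, i < j →
      (Pi.single i (1 : ℝ) + Pi.single j (1 : ℝ) : Fin n → ℝ) ∉ B) :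
    ∃ D : Finset (Fin n → ℝ), D.card = 2 ^ (n - 1) + 2 ∧
      ∀ x ∈ frontier B, ∃ d ∈ D, ∃ ε : ℝ, 0 < ε ∧ x + ε • d ∈ interior B := by
  obtain ⟨m, rfl⟩ : ∃ m, n = m + 1 := ⟨n - 1, by omega⟩
  have : NeZero m := ⟨by omega⟩
  have hcl := hB_comp.isClosed
  have hfr : frontier B ⊆ B := hcl.frontier_subset
  let E : Finset (Fin (m + 1) → ℝ) :=
    Finset.univ.image dominatedSignVector ∪ {Pi.single 0 1, Pi.single 0 (-1)}
  have hE : E.card ≤ 2 ^ (m + 1 - 1) + 2 := by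
    refine (Finset.card_union_le _ _).trans (add_le_add ?_ Finset.card_le_two)
    refine Finset.card_image_le.trans ?_
    simp
  obtain ⟨D, hED, hD⟩ := Infinite.exists_superset_card_eq E _ hE
  refine ⟨D, hD, fun x hxf => ?_⟩
  have hx := hfr hxf
  suffices h : ∃ d ∈ E, ∀ a : Fin (m + 1) → ℝ, a ≠ 0 →
      (∀ b ∈ B, ∑ i, a i * b i ≤ ∑ i, a i * x i) → ∑ i, a i * d i < 0 by
    obtain ⟨d, hd, h⟩ := h
    exact ⟨d, hED hd, exists_add_smul_mem_interior hB_conv hB_int hx h⟩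
  by_cases hmax : ∀ j, j ≠ 0 → |x j| < |x 0|
  · have hx0 : x 0 ≠ 0 := by
      have h := hmax (Fin.last m) (by
        rw [Ne, Fin.ext_iff]; simp only [Fin.val_last, Fin.val_zero]; omega)
      exact abs_pos.mp ((abs_nonneg _).trans_lt h)
    refine ⟨Pi.single 0 (if 0 < x 0 then -1 else 1), ?_, fun a ha0 ha => ?_⟩
    · split_ifs <;> simp [E]
    have h0 : a 0 ≠ 0 := fun h0 => ha0 <| funext fun j => by
      by_cases hj : j = 0
      · rw [hj, h0]; rfl
      · simpa [h0] using abs_le_abs_of_supporting hB_sym hx ha (hmax j hj)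
    have hs := mul_eq_abs_mul_abs_of_supporting hB_sym hx ha 0
    have hp : 0 < a 0 * x 0 := hs ▸ mul_pos (abs_pos.mpr h0) (abs_pos.mpr hx0)
    rw [Finset.sum_eq_single 0 (fun j _ hj => by simp [hj]) (by simp), Pi.single_eq_same]
    split_ifs with hpos
    · linarith [pos_of_mul_pos_left hp hpos.le]
    · have := neg_of_mul_pos_left hp (not_lt.mp hpos)
      linarith
  · push Not at hmax
    obtain ⟨j, hj0, hj⟩ := hmax
    have htail : ∀ a : Fin (m + 1) → ℝ, a ≠ 0 →
        (∀ b ∈ B, ∑ i, a i * b i ≤ ∑ i, a i * x i) → ∃ k : Fin m, a k.succ ≠ 0 := by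
      intro a ha0 ha
      by_contra! hk
      have h0 : a 0 ≠ 0 := fun h0 => ha0 <| funext fun i => Fin.cases h0 hk i
      have h := abs_le_sum_of_supporting hB_sym ha (hfr (hB_norm 0))
      rw [Fin.sum_univ_succ, Finset.sum_eq_zero (fun k _ => by rw [hk k, zero_mul]), add_zero,
        mul_eq_abs_mul_abs_of_supporting hB_sym hx ha 0] at h
      have h1 : 1 ≤ |x 0| := by
        by_contra! hlt
        nlinarith [abs_pos.mpr h0]
      exact absurd (h1.trans hj) (not_le.mpr
        (abs_lt_one_of_single_add_single_notMem hB_conv hcl hB_sym hj0.symm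
          (hno2 0 j (Fin.pos_iff_ne_zero.mpr hj0)) hx h1))
    let T : Finset (Fin m) := {k | x k.succ = 0}
    let P : Finset (Fin m) := {k | 0 < x k.succ}
    by_cases hT : T.card < m
    · obtain ⟨R, hRT, hR⟩ := exists_finset_card_mod_notMem P T (by
        rw [Finset.disjoint_left]
        intro k hk hk'
        simp only [P, T, Finset.mem_filter_univ] at hk hk'
        linarith) hT
      refine ⟨dominatedSignVector (P ∪ R), by simp [E], fun a ha0 ha => ?_⟩
      refine sum_mul_dominatedSignVector_neg hR (htail a ha0 ha) ?_ ?_ ?_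
      · intro k hk hkP
        have hkx : 0 < x k.succ := by
          rcases Finset.mem_union.mp hkP with h | h
          · simpa [P] using h
          · exact absurd (hRT h) hk
        have hs := mul_eq_abs_mul_abs_of_supporting hB_sym hx ha k.succ
        exact nonneg_of_mul_nonneg_left (hs ▸ by positivity) hkx
      · intro k hk hkP
        have hkx : x k.succ < 0 := by
          simp only [P, T, Finset.mem_union, Finset.mem_filter_univ, not_or, not_lt] at hk hkP
          exact lt_of_le_of_ne hkP.1 hk
        have hs := mul_eq_abs_mul_abs_of_supporting hB_sym hx ha k.succ
        have : 0 ≤ a k.succ * x k.succ := hs ▸ by positivity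
        by_contra! hpos
        nlinarith [mul_neg_of_pos_of_neg hpos hkx]
      · intro k hk l hl
        simp only [T, Finset.mem_filter_univ] at hk hl
        exact abs_le_abs_of_supporting hB_sym hx ha (by simpa [hk] using hl)
    · have hT' : T = Finset.univ := by
        refine (Finset.card_eq_iff_eq_univ _).mp (le_antisymm (Finset.card_le_univ T) ?_)
        simpa using hT
      have hxs : ∀ k : Fin m, x k.succ = 0 := fun k => by
        have : k ∈ T := hT' ▸ Finset.mem_univ k
        simpa [T] using this
      have hx0 : x 0 = 0 := by
        obtain ⟨k, rfl⟩ := Fin.exists_succ_eq.mpr hj0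
        simpa [hxs k] using hj
      have hxz : x = 0 := funext fun i => Fin.cases hx0 hxs i
      refine ⟨Pi.single 0 1, by simp [E], fun a ha0 ha => absurd (funext fun i => ?_) ha0⟩
      simpa [hxz] using abs_le_sum_of_supporting hB_sym ha (hfr (hB_norm i))
end

section
/- For every natural number n ≥ 3 one has 2·∑_{s=0}^{⌊(n−1)/4⌋} C(n,s) ≤ 2^{n−1} − 2, where C(n,s) is the binomial coefficient. Moreover, for every n ≥ 4 with n ≠ 5 and n ≠ 6, the stronger bound 2·∑_{s=0}^{⌊(n−1)/4⌋} C(n,s) ≤ 2^{n−1} − C(n, ⌊n/2⌋) holds. -/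
/-- Twice a binomial coefficient is at most the next one in the first third of a row. -/
lemma two_mul_choose_le_choose_succ {n j : ℕ} (h : 3 * j + 2 ≤ n) :
    2 * n.choose j ≤ n.choose (j + 1) := by
  have hmul := Nat.choose_succ_right_eq n j
  have hsub : 2 * (j + 1) ≤ n - j := by omega
  refine Nat.le_of_mul_le_mul_right ?_ (Nat.succ_pos j)
  calc 2 * n.choose j * (j + 1) = n.choose j * (2 * (j + 1)) := by ring
    _ ≤ n.choose j * (n - j) := Nat.mul_le_mul_left _ hsub
    _ = n.choose (j + 1) * (j + 1) := hmul.symm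

/-- In the first third of a row, a binomial coefficient dominates the sum of its predecessors. -/
lemma sum_range_choose_le_choose {n j : ℕ} (h : 3 * j ≤ n + 1) :
    ∑ s ∈ Finset.range j, n.choose s ≤ n.choose j := by
  induction j with
  | zero => simp
  | succ j ih =>
    rw [Finset.sum_range_succ]
    have h₁ := ih (by omega)
    have h₂ := two_mul_choose_le_choose_succ (n := n) (j := j) (by omega)
    omega

/-- The quarter-row bound for odd rows. -/
lemma two_mul_sum_choose_add_choose_le_four_pow {m : ℕ} (hm : 3 ≤ m) :
    2 * (∑ s ∈ Finset.range (m / 2 + 1), (2 * m + 1).choose s) + (2 * m + 1).choose m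
      ≤ 4 ^ m := by
  have hS := sum_range_choose_le_choose (n := 2 * m + 1) (j := m / 2 + 1) (by omega)
  have hle : ∑ s ∈ Finset.range (m / 2 + 1 + 1), (2 * m + 1).choose s
      ≤ ∑ s ∈ Finset.range m, (2 * m + 1).choose s :=
    Finset.sum_le_sum_of_subset (Finset.range_mono (by omega))
  rw [Finset.sum_range_succ] at hle
  rw [← Nat.sum_range_choose_halfway m, Finset.sum_range_succ _ m]
  omega

/-- A partial row sum at most doubles when passing to the next row. -/
lemma sum_range_choose_succ_le (n j : ℕ) :
    ∑ s ∈ Finset.range j, (n + 1).choose s ≤ 2 * ∑ s ∈ Finset.range j, n.choose s := by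
  cases j with
  | zero => simp
  | succ j =>
    have hp : ∑ s ∈ Finset.range (j + 1), (n + 1).choose s
        = ∑ s ∈ Finset.range j, n.choose s + ∑ s ∈ Finset.range (j + 1), n.choose s := by
      rw [Finset.sum_range_succ', Finset.sum_range_succ' (fun s => n.choose s)]
      simp only [Nat.choose_succ_succ', Finset.sum_add_distrib, Nat.choose_zero_right]
      ring
    rw [hp, Finset.sum_range_succ]
    omega

/-- The quarter-row bound for all rows from the seventh on. -/
lemma two_mul_sum_choose_add_central_le {n : ℕ} (hn : 7 ≤ n) :
    2 * (∑ s ∈ Finset.range ((n - 1) / 4 + 1), n.choose s) + n.choose (n / 2)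
      ≤ 2 ^ (n - 1) := by
  have hpow (m : ℕ) : 2 ^ (2 * m) = 4 ^ m := by rw [pow_mul]; norm_num
  obtain ⟨m, rfl | rfl⟩ : ∃ m, n = 2 * m + 1 ∨ n = 2 * m + 1 + 1 :=
    ⟨(n - 1) / 2, by omega⟩
  · have h := two_mul_sum_choose_add_choose_le_four_pow (m := m) (by omega)
    rwa [show (2 * m + 1 - 1) / 4 = m / 2 by omega, show (2 * m + 1) / 2 = m by omega,
      Nat.add_sub_cancel, hpow]
  · have h := two_mul_sum_choose_add_choose_le_four_pow (m := m) (by omega)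
    have hd := sum_range_choose_succ_le (2 * m + 1) (m / 2 + 1)
    have hsymm := Nat.choose_symm_half m
    rw [show (2 * m + 1 + 1 - 1) / 4 = m / 2 by omega,
      show (2 * m + 1 + 1) / 2 = m + 1 by omega, Nat.add_sub_cancel, pow_succ, hpow,
      Nat.choose_succ_succ' (2 * m + 1) m]
    omega

/-- Binomial-sum estimates: for `n ≥ 3`,
`2·∑_{s=0}^{⌊(n-1)/4⌋} C(n,s) ≤ 2^(n-1) - 2`, and for `n ≥ 4`, `n ∉ {5,6}`, the stronger
bound `2·∑_{s=0}^{⌊(n-1)/4⌋} C(n,s) ≤ 2^(n-1) - C(n, ⌊n/2⌋)` holds. -/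
theorem stmt_12 :
    ∀ n : ℕ, 3 ≤ n →
      (2 * (∑ s ∈ Finset.range ((n - 1) / 4 + 1), n.choose s) + 2 ≤ 2 ^ (n - 1)) ∧
      (4 ≤ n → n ≠ 5 → n ≠ 6 →
        2 * (∑ s ∈ Finset.range ((n - 1) / 4 + 1), n.choose s) + n.choose (n / 2)
          ≤ 2 ^ (n - 1)) := by
  intro n hn
  rcases Nat.lt_or_ge n 7 with hlt | hge
  · interval_cases n <;> decide
  · have h := two_mul_sum_choose_add_central_le hge
    refine ⟨?_, fun _ _ _ => h⟩
    have hc : n.choose 1 ≤ n.choose (n / 2) := Nat.choose_le_middle 1 n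
    rw [Nat.choose_one_right] at hc
    omega
end

section
/- Let n ≥ 4 and let B be a 1-symmetric convex body in ℝⁿ with each standard basis vector e_i on its boundary, such that every k with e_1 + ⋯ + e_k ∈ B satisfies 2k ≤ n. Then B can be illuminated by a set of directions of cardinality at most 2^{n−1} + 4·∑_{s=0}^{⌊(n−2)/4⌋} C(n−1,s), and hence the illumination number of B is at most 2ⁿ − 4. -/
open Finset in
/-- A direction illuminates `x` as soon as every outer normal of the symmetric convex set `B` at `x`
is negative on it. -/
theorem exists_add_smul_mem_interior_of_forall_normal {n : ℕ} {B : Set (Fin n → ℝ)}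
    (hconv : Convex ℝ B) (hint : (interior B).Nonempty) (hneg : ∀ y ∈ B, -y ∈ B)
    {x d : Fin n → ℝ} (hx : x ∈ B)
    (h : ∀ g : Fin n → ℝ, (∀ y ∈ B, ∑ i, g i * y i ≤ ∑ i, g i * x i) →
      0 < ∑ i, g i * x i → ∑ i, g i * d i < 0) :
    ∃ ε : ℝ, 0 < ε ∧ x + ε • d ∈ interior B := by
  by_contra! hcon
  have hray : Convex ℝ ((fun ε : ℝ => x + ε • d) '' Set.Ioi 0) := by
    rintro _ ⟨a, ha, rfl⟩ _ ⟨b, hb, rfl⟩ s t hs ht hst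
    refine ⟨s * a + t * b, (convex_Ioi (0 : ℝ)) ha hb hs ht hst, ?_⟩
    ext i
    simp only [Pi.add_apply, Pi.smul_apply, smul_eq_mul]
    linear_combination (-x i) * hst
  have hdisj : Disjoint (interior B) ((fun ε : ℝ => x + ε • d) '' Set.Ioi 0) := by
    rw [Set.disjoint_left]
    rintro _ hy ⟨ε, hε, rfl⟩
    exact hcon ε hε hy
  obtain ⟨f, u, hfu, huf⟩ := geometric_hahn_banach_open hconv.interior isOpen_interior hray hdisj
  have hfB : ∀ y ∈ B, f y ≤ u := by
    intro y hy
    have hy' : y ∈ closure (interior B) := by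
      rw [hconv.closure_interior_eq_closure_of_nonempty_interior hint]
      exact subset_closure hy
    exact closure_minimal (fun z hz => (hfu z hz).le) (isClosed_le f.continuous continuous_const) hy'
  have hray' : ∀ ε : ℝ, 0 < ε → u ≤ f x + ε * f d := by
    intro ε hε
    simpa using huf _ ⟨ε, hε, rfl⟩
  have hux : u ≤ f x := by
    refine le_of_forall_pos_le_add fun δ hδ => ?_
    have h1 := hray' (δ / (|f d| + 1)) (by positivity)
    have h2 : δ / (|f d| + 1) * f d ≤ δ := by
      rw [div_mul_eq_mul_div, div_le_iff₀ (by positivity)]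
      nlinarith [le_abs_self (f d)]
    linarith
  have hfx : f x = u := le_antisymm (hfB x hx) hux
  have hfd : 0 ≤ f d := by
    have := hray' 1 one_pos
    linarith
  have hu : 0 < u := by
    obtain ⟨a, ha⟩ := hint
    have h1 := hfu a ha
    have h2 := hfB _ (hneg a (interior_subset ha))
    rw [map_neg] at h2
    linarith
  have hf : ∀ y, f y = ∑ i, f (Pi.single i 1) * y i := by
    intro y
    have := LinearMap.pi_apply_eq_sum_univ f.toLinearMap y
    simp only [ContinuousLinearMap.coe_coe, smul_eq_mul] at this
    rw [this]
    refine sum_congr rfl fun i _ => ?_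
    rw [mul_comm]
    congr 2
    ext j
    simp [Pi.single_apply, eq_comm]
  have := h (fun i => f (Pi.single i 1)) (fun y hy => by rw [← hf, ← hf, hfx]; exact hfB y hy)
    (by rw [← hf, hfx]; exact hu)
  rw [← hf] at this
  linarith

/-- An unconditional convex set is closed under decreasing the absolute values of coordinates. -/
theorem mem_of_forall_abs_le {n : ℕ} {B : Set (Fin n → ℝ)} (hconv : Convex ℝ B)
    (hB : ∀ x ∈ B, ∀ ε : Fin n → ℝ, (∀ i, ε i = 1 ∨ ε i = -1) → (fun i => ε i * x i) ∈ B)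
    {x y : Fin n → ℝ} (hx : x ∈ B) (h : ∀ i, |y i| ≤ |x i|) : y ∈ B := by
  have key : ∀ S : Finset (Fin n), (fun i => if i ∈ S then y i else x i) ∈ B := by
    intro S
    induction S using Finset.induction_on with
    | empty => simpa using hx
    | insert a S ha ih =>
      set z : Fin n → ℝ := fun i => if i ∈ S then y i else x i with hz
      have hflip := hB z ih (fun i => if i = a then -1 else 1)
        (fun i => by by_cases hi : i = a <;> simp [hi])
      have hza : z a = x a := by simp [hz, ha]
      obtain ⟨s, t, hs, ht, hst, hy⟩ :
          ∃ s t : ℝ, 0 ≤ s ∧ 0 ≤ t ∧ s + t = 1 ∧ y a = s * x a + t * (-x a) := by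
        by_cases hxa : x a = 0
        · refine ⟨1, 0, by norm_num, by norm_num, by norm_num, ?_⟩
          have := h a
          rw [hxa, abs_zero] at this
          simp [hxa, abs_nonpos_iff.1 this]
        · have hr : |y a / x a| ≤ 1 := by
            rw [abs_div]
            exact div_le_one_of_le₀ (h a) (abs_nonneg _)
          rw [abs_le] at hr
          refine ⟨(1 + y a / x a) / 2, (1 - y a / x a) / 2, by linarith, by linarith, by ring, ?_⟩
          field_simp
          ring
      convert hconv ih hflip hs ht hst using 1
      ext i
      by_cases hi : i = a
      · subst hi
        simp [hza, hy]
      · simp only [Finset.mem_insert, hi, false_or, Pi.add_apply, Pi.smul_apply, smul_eq_mul,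
          if_false, one_mul, ← add_mul, hst]
        rfl
  simpa using key Finset.univ

section Normal

variable {n : ℕ} {B : Set (Fin n → ℝ)} {x g : Fin n → ℝ}

/-- A normal of a 1-symmetric body at `x` dominates all rearrangements of `|x|`. -/
theorem sum_abs_mul_abs_comp_perm_le
    (hB : ∀ x ∈ B, ∀ σ : Equiv.Perm (Fin n), ∀ ε : Fin n → ℝ,
      (∀ i, ε i = 1 ∨ ε i = -1) → (fun i => ε i * x (σ i)) ∈ B)
    (hx : x ∈ B) (hg : ∀ y ∈ B, ∑ i, g i * y i ≤ ∑ i, g i * x i) (σ : Equiv.Perm (Fin n)) :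
    ∑ i, |g i| * |x (σ i)| ≤ ∑ i, g i * x i := by
  have h := hg _ (hB x hx σ (fun i => if 0 ≤ g i * x (σ i) then 1 else -1)
    (fun i => by split_ifs <;> simp))
  refine le_trans (le_of_eq (Finset.sum_congr rfl fun i _ => ?_)) h
  rw [← abs_mul]
  split_ifs with h0
  · rw [abs_of_nonneg h0]; ring
  · rw [abs_of_neg (not_le.1 h0)]; ring

theorem normal_mul_nonneg
    (hB : ∀ x ∈ B, ∀ σ : Equiv.Perm (Fin n), ∀ ε : Fin n → ℝ,
      (∀ i, ε i = 1 ∨ ε i = -1) → (fun i => ε i * x (σ i)) ∈ B)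
    (hx : x ∈ B) (hg : ∀ y ∈ B, ∑ i, g i * y i ≤ ∑ i, g i * x i) (i : Fin n) :
    0 ≤ g i * x i := by
  have h := sum_abs_mul_abs_comp_perm_le hB hx hg 1
  have h1 : ∀ j ∈ Finset.univ, 0 ≤ |g j| * |x j| - g j * x j := fun j _ => by
    rw [← abs_mul]; linarith [le_abs_self (g j * x j)]
  have h2 : ∑ j, (|g j| * |x j| - g j * x j) ≤ 0 := by
    rw [Finset.sum_sub_distrib]
    simpa using h
  have h3 := (Finset.single_le_sum h1 (Finset.mem_univ i)).trans h2
  have : 0 ≤ |g i| * |x i| := by positivity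
  linarith

theorem abs_normal_le_of_abs_lt
    (hB : ∀ x ∈ B, ∀ σ : Equiv.Perm (Fin n), ∀ ε : Fin n → ℝ,
      (∀ i, ε i = 1 ∨ ε i = -1) → (fun i => ε i * x (σ i)) ∈ B)
    (hx : x ∈ B) (hg : ∀ y ∈ B, ∑ i, g i * y i ≤ ∑ i, g i * x i) {i j : Fin n}
    (hij : |x j| < |x i|) : |g j| ≤ |g i| := by
  have hne : i ≠ j := by rintro rfl; exact lt_irrefl _ hij
  have h := sum_abs_mul_abs_comp_perm_le hB hx hg (Equiv.swap i j)
  have h1 : ∑ k, g k * x k ≤ ∑ k, |g k| * |x k| :=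
    Finset.sum_le_sum fun k _ => by rw [← abs_mul]; exact le_abs_self _
  have h2 : ∑ k, (|g k| * |x (Equiv.swap i j k)| - |g k| * |x k|)
      = (|g i| * |x j| - |g i| * |x i|) + (|g j| * |x i| - |g j| * |x j|) := by
    rw [← Finset.sum_subset (Finset.subset_univ {i, j}), Finset.sum_pair hne]
    · simp
    · intro k _ hk
      simp only [Finset.mem_insert, Finset.mem_singleton, not_or] at hk
      rw [Equiv.swap_apply_of_ne_of_ne hk.1 hk.2, sub_self]
  rw [Finset.sum_sub_distrib] at h2
  by_contra! hlt
  nlinarith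

end Normal

/-- Negativity of a normal on a direction with one dominating coordinate. -/
theorem sum_mul_neg_of_dominating {n : ℕ} {g d x : Fin n → ℝ} {J : Finset (Fin n)} {a : Fin n}
    (ha : a ∈ J) (hda : |d a| = 1) (hgx : ∀ i, 0 ≤ g i * x i) (hxd : ∀ i ∈ J, x i * d i < 0)
    (hout : ∀ j ∉ J, |g j * d j| ≤ 1 / n * |g a|) (hne : ∃ i ∈ J, g i ≠ 0) :
    ∑ i, g i * d i < 0 := by
  have hnpos : (0 : ℝ) < n := by exact_mod_cast a.pos
  have hle : ∀ i ∈ J, g i * d i ≤ 0 := by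
    intro i hi
    have h1 := hgx i
    have h2 := hxd i hi
    by_contra! hlt
    have hx2 : 0 < x i * x i := mul_self_pos.2 (by rintro h0; simp [h0] at h2)
    nlinarith [mul_pos hlt hx2, mul_nonneg h1 (neg_nonneg.2 h2.le)]
  have hcard : ((Jᶜ).card : ℝ) + 1 ≤ n := by
    have h1 := Finset.card_compl_add_card J
    have h2 := Finset.card_pos.2 ⟨a, ha⟩
    rw [Fintype.card_fin] at h1
    exact_mod_cast (by omega : (Jᶜ).card + 1 ≤ n)
  have hsum_out : ∑ j ∈ Jᶜ, g j * d j ≤ (Jᶜ).card * (1 / n * |g a|) := by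
    have := Finset.sum_le_card_nsmul (Jᶜ) (fun j => g j * d j) (1 / n * |g a|)
      fun j hj => (le_abs_self _).trans (hout j (Finset.mem_compl.1 hj))
    simpa using this
  rw [← Finset.sum_add_sum_compl J]
  rcases eq_or_ne (g a) 0 with h0 | h0
  · rw [h0, abs_zero, mul_zero, mul_zero] at hsum_out
    obtain ⟨i, hi, hgi⟩ := hne
    have hlt : ∑ i ∈ J, g i * d i < 0 := by
      refine Finset.sum_neg' hle ⟨i, hi, lt_of_le_of_ne (hle i hi) (mul_ne_zero hgi ?_)⟩
      intro hd
      have := hxd i hi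
      simp [hd] at this
    linarith
  · have hga : g a * d a = -|g a| := by
      have h1 := abs_of_nonpos (hle a ha)
      rw [abs_mul, hda] at h1
      linarith
    have hJ : ∑ i ∈ J, g i * d i ≤ -|g a| := by
      rw [← hga]
      have := Finset.single_le_sum (f := fun i => -(g i * d i))
        (fun i hi => neg_nonneg.2 (hle i hi)) ha
      rw [Finset.sum_neg_distrib] at this
      linarith
    have hpos : 0 < |g a| := abs_pos.2 h0
    have h3 : ((Jᶜ).card : ℝ) * (1 / n * |g a|) ≤ (n - 1) * (1 / n * |g a|) :=
      mul_le_mul_of_nonneg_right (by linarith) (by positivity)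
    have h4 : ((n : ℝ) - 1) * (1 / n * |g a|) = |g a| - 1 / n * |g a| := by
      field_simp
    have h5 : 0 < 1 / (n : ℝ) * |g a| := by positivity
    linarith

section Counting

theorem sum_range_choose_succ_add_choose (N k : ℕ) :
    ∑ s ∈ Finset.range (k + 1), (N + 1).choose s + N.choose k
      = 2 * ∑ s ∈ Finset.range (k + 1), N.choose s := by
  induction k with
  | zero => simp
  | succ k ih =>
    rw [Finset.sum_range_succ, Finset.sum_range_succ (fun s => N.choose s),
      Nat.choose_succ_succ]
    simp only [Nat.succ_eq_add_one] at *
    omega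

theorem sum_range_choose_add_four_le (k : ℕ) :
    ∑ s ∈ Finset.range (k + 2), (4 * k + 5).choose s
      ≤ 16 * ∑ s ∈ Finset.range (k + 1), (4 * k + 1).choose s := by
  have h (M j : ℕ) := sum_range_choose_succ_add_choose M j
  have e (M : ℕ) := Finset.sum_range_succ (fun s => M.choose s) (k + 1)
  have hc : (4 * k + 1).choose (k + 1) ≤ 3 * (4 * k + 1).choose k := by
    have h1 := Nat.choose_succ_right_eq (4 * k + 1) k
    have h2 : 4 * k + 1 - k = 3 * k + 1 := by omega
    rw [h2] at h1
    refine Nat.le_of_mul_le_mul_right (c := k + 1) ?_ (by omega)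
    rw [h1]
    nlinarith [Nat.zero_le ((4 * k + 1).choose k)]
  have a1 := h (4 * k + 1) k
  have a2 := h (4 * k + 2) k
  have a3 := h (4 * k + 3) k
  have b1 := h (4 * k + 1) (k + 1)
  have b2 := h (4 * k + 2) (k + 1)
  have b3 := h (4 * k + 3) (k + 1)
  have b4 := h (4 * k + 4) (k + 1)
  have e1 := e (4 * k + 1)
  have e2 := e (4 * k + 2)
  have e3 := e (4 * k + 3)
  have e4 := e (4 * k + 4)
  simp only [Nat.add_assoc, Nat.reduceAdd] at *
  omega

theorem sum_range_choose_quarter_lt (k r : ℕ) :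
    ∑ s ∈ Finset.range (k + 2), (4 * k + 5 + r).choose s + 1 ≤ 2 ^ (4 * k + 3 + r) := by
  induction r with
  | zero =>
    induction k with
    | zero => decide
    | succ k ih =>
      have h := sum_range_choose_add_four_le (k + 1)
      have hp : 2 ^ (4 * (k + 1) + 3) = 16 * 2 ^ (4 * k + 3) := by
        rw [show 4 * (k + 1) + 3 = (4 * k + 3) + 4 by ring, pow_add]; ring
      simp only [Nat.add_zero, Nat.add_assoc, Nat.reduceAdd, Nat.mul_add, Nat.reduceMul] at *
      omega
  | succ r ih =>
    have h := sum_range_choose_succ_add_choose (4 * k + 5 + r) (k + 1)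
    simp only [Nat.add_assoc, Nat.reduceAdd] at *
    have hp : 2 ^ (4 * k + (3 + (r + 1))) = 2 * 2 ^ (4 * k + (3 + r)) := by
      rw [← pow_succ']; rfl
    omega

theorem card_bound {n : ℕ} (hn : 4 ≤ n) :
    2 ^ (n - 1) + 4 * (∑ s ∈ Finset.range ((n - 2) / 4 + 1), (n - 1).choose s) ≤ 2 ^ n - 4 := by
  have key : ∑ s ∈ Finset.range ((n - 2) / 4 + 1), (n - 1).choose s + 1 ≤ 2 ^ (n - 3) := by
    rcases Nat.eq_zero_or_pos ((n - 2) / 4) with h | h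
    · rw [h]
      have : 2 ^ 1 ≤ 2 ^ (n - 3) := Nat.pow_le_pow_right (by norm_num) (by omega)
      simpa using this
    · obtain ⟨k, hk⟩ : ∃ k, (n - 2) / 4 = k + 1 := ⟨(n - 2) / 4 - 1, by omega⟩
      obtain ⟨r, hr⟩ : ∃ r, n = 4 * k + 6 + r := ⟨n - (4 * k + 6), by omega⟩
      have := sum_range_choose_quarter_lt k r
      rw [hk, show n - 1 = 4 * k + 5 + r by omega, show n - 3 = 4 * k + 3 + r by omega]
      exact this
  have h1 : 2 ^ (n - 1) = 4 * 2 ^ (n - 3) := by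
    rw [show n - 1 = (n - 3) + 2 by omega, pow_add]; ring
  have h2 : 2 ^ n = 8 * 2 ^ (n - 3) := by
    conv_lhs => rw [show n = (n - 3) + 3 by omega, pow_add]
    ring
  omega

end Counting

/-- The set `A` has at most as many elements as its complement in the coordinates other than `l`;
ties are broken in favour of the set containing `o`. -/
def IsMinority {n : ℕ} (l o : Fin n) (A : Finset (Fin n)) : Prop :=
  A.card < (Finset.univ.erase l \ A).card ∨
    (A.card = (Finset.univ.erase l \ A).card ∧ o ∈ A)

theorem isMinority_or_isMinority {n : ℕ} {l o : Fin n} (hol : o ≠ l) {A A' : Finset (Fin n)}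
    (hA : A ⊆ Finset.univ.erase l) (hA' : A' ⊆ Finset.univ.erase l) (hd : Disjoint A A') :
    IsMinority l o A ∨ IsMinority l o A' := by
  have h1 : A' ⊆ Finset.univ.erase l \ A := Finset.subset_sdiff.2 ⟨hA', hd.symm⟩
  have h2 : A ⊆ Finset.univ.erase l \ A' := Finset.subset_sdiff.2 ⟨hA, hd⟩
  have c1 := Finset.card_le_card h1
  have c2 := Finset.card_le_card h2
  by_contra! hcon
  obtain ⟨n1, n2⟩ := hcon
  unfold IsMinority at n1 n2
  push Not at n1 n2
  have hoA := n1.2 (by omega)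
  have hoA' := n2.2 (by omega)
  have heq := Finset.eq_of_subset_of_card_le h1 (by omega)
  rw [heq] at hoA'
  simp [hoA, hol] at hoA'

/-- The direction equal to `1` on `A`, to `0` at `l` and to `-1/n` elsewhere. -/
noncomputable def spike {n : ℕ} (l : Fin n) (A : Finset (Fin n)) : Fin n → ℝ :=
  fun i => if i = l then 0 else if i ∈ A then 1 else -(1 / n)

/-- The direction equal to `0` at `l`, to `1/n` at `o` and to `1` elsewhere. -/
noncomputable def flat {n : ℕ} (l o : Fin n) : Fin n → ℝ :=
  fun i => if i = l then 0 else if i = o then 1 / n else 1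

open Classical in
/-- The direction associated with the sign pattern that is positive exactly on `P`. -/
noncomputable def patternDirection {n : ℕ} (l o : Fin n) (P : Finset (Fin n)) : Fin n → ℝ :=
  if P = ∅ then -flat l o
  else if P = Finset.univ.erase l then flat l o
  else if IsMinority l o P then spike l P
  else -spike l (Finset.univ.erase l \ P)

open Classical in
/-- All directions associated with sign patterns of the coordinates other than `l`. -/
noncomputable def patternDirections {n : ℕ} (l o : Fin n) : Finset (Fin n → ℝ) :=
  (Finset.univ.erase l).powerset.image (patternDirection l o)

open Classical in
/-- Directions of the form `±spike l A`, with `A` of size at most `q`, modified to be `±1`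
at `l`. -/
noncomputable def sparseDirections {n : ℕ} (l : Fin n) (q : ℕ) : Finset (Fin n → ℝ) :=
  (((Finset.range (q + 1)).biUnion fun s => (Finset.univ.erase l).powersetCard s) ×ˢ
    (({1, -1} : Finset ℝ) ×ˢ ({1, -1} : Finset ℝ))).image
      fun p => Function.update (p.2.1 • spike l p.1) l p.2.2

theorem card_patternDirections_le {n : ℕ} (l o : Fin n) :
    (patternDirections l o).card ≤ 2 ^ (n - 1) := by
  refine Finset.card_image_le.trans (le_of_eq ?_)
  rw [Finset.card_powerset, Finset.card_erase_of_mem (Finset.mem_univ l), Finset.card_univ,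
    Fintype.card_fin]

theorem card_sparseDirections_le {n : ℕ} (l : Fin n) (q : ℕ) :
    (sparseDirections l q).card ≤ 4 * ∑ s ∈ Finset.range (q + 1), (n - 1).choose s := by
  refine Finset.card_image_le.trans ?_
  rw [Finset.card_product, Finset.card_product, mul_comm 4]
  refine Nat.mul_le_mul (Finset.card_biUnion_le.trans (le_of_eq ?_)) ?_
  · refine Finset.sum_congr rfl fun s _ => ?_
    rw [Finset.card_powersetCard, Finset.card_erase_of_mem (Finset.mem_univ l), Finset.card_univ,
      Fintype.card_fin]
  · exact (Nat.mul_le_mul Finset.card_le_two Finset.card_le_two).trans (by norm_num)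

theorem update_spike_mem_sparseDirections {n : ℕ} {l : Fin n} {q : ℕ} {A : Finset (Fin n)}
    (hA : A ⊆ Finset.univ.erase l) (hq : A.card ≤ q) {σ τ : ℝ} (hσ : σ = 1 ∨ σ = -1)
    (hτ : τ = 1 ∨ τ = -1) :
    Function.update (σ • spike l A) l τ ∈ sparseDirections l q := by
  refine Finset.mem_image.2 ⟨(A, σ, τ), ?_, rfl⟩
  simp only [Finset.mem_product, Finset.mem_biUnion, Finset.mem_range, Finset.mem_powersetCard,
    Finset.mem_insert, Finset.mem_singleton]
  exact ⟨⟨A.card, by omega, hA, rfl⟩, hσ, hτ⟩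

theorem smul_flat_mem_patternDirections {n : ℕ} {l o : Fin n} (hol : o ≠ l) {σ : ℝ}
    (hσ : σ = 1 ∨ σ = -1) : σ • flat l o ∈ patternDirections l o := by
  have hE : Finset.univ.erase l ≠ ∅ :=
    Finset.ne_empty_of_mem (Finset.mem_erase.2 ⟨hol, Finset.mem_univ o⟩)
  rcases hσ with rfl | rfl
  · exact Finset.mem_image.2 ⟨Finset.univ.erase l, by simp, by simp [patternDirection, hE]⟩
  · exact Finset.mem_image.2 ⟨∅, by simp, by simp [patternDirection]⟩

theorem smul_spike_mem_patternDirections {n : ℕ} {l o : Fin n} {A : Finset (Fin n)}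
    (hA : A ⊆ Finset.univ.erase l) (hne : A.Nonempty) (hmin : IsMinority l o A) {σ : ℝ}
    (hσ : σ = 1 ∨ σ = -1) : σ • spike l A ∈ patternDirections l o := by
  have hpos := hne.card_pos
  have hdd : Finset.univ.erase l \ (Finset.univ.erase l \ A) = A := Finset.sdiff_sdiff_eq_self hA
  have hcne : Finset.univ.erase l \ A ≠ ∅ := by
    intro h
    rcases hmin with h1 | h1 <;> rw [h, Finset.card_empty] at h1 <;> omega
  rcases hσ with rfl | rfl
  · refine Finset.mem_image.2 ⟨A, Finset.mem_powerset.2 hA, ?_⟩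
    have hAE : A ≠ Finset.univ.erase l := by
      intro h
      exact hcne (by rw [← h, Finset.sdiff_self])
    simp [patternDirection, hne.ne_empty, hAE, hmin]
  · refine Finset.mem_image.2 ⟨Finset.univ.erase l \ A,
      Finset.mem_powerset.2 Finset.sdiff_subset, ?_⟩
    have hcE : Finset.univ.erase l \ A ≠ Finset.univ.erase l := by
      intro h
      rw [h, Finset.sdiff_self] at hdd
      exact hne.ne_empty hdd.symm
    have hnot : ¬ IsMinority l o (Finset.univ.erase l \ A) := by
      rintro (h | h) <;> rw [hdd] at h
      · rcases hmin with h1 | h1 <;> omega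
      · rcases hmin with h1 | h1
        · omega
        · exact (Finset.mem_sdiff.1 h.2).2 h1.2
    simp only [patternDirection, hcne, hcE, hnot, if_false, hdd, neg_smul, one_smul]

/-- Negativity of a normal on a direction of constant sign. -/
theorem sum_mul_neg_of_flat {n : ℕ} {g d x : Fin n → ℝ} {J : Finset (Fin n)} {l o : Fin n}
    (hn : 2 ≤ n) (hol : o ≠ l) (hJ : J ⊆ Finset.univ.erase l) (hd : ∀ i, |d i| = flat l o i)
    (hgx : ∀ i, 0 ≤ g i * x i) (hxd : ∀ i ∈ J, x i * d i < 0)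
    (hout : ∀ i ∈ J, ∀ j ∉ J, j ≠ l → |g j| ≤ |g i|) (hne : ∃ i ∈ J, g i ≠ 0)
    (hmin : ¬ IsMinority l o J) :
    ∑ i, g i * d i < 0 := by
  have hn' : (2 : ℝ) ≤ n := by exact_mod_cast hn
  have hη : 0 < 1 / (n : ℝ) := by positivity
  have hη1 : 1 / (n : ℝ) < 1 := by
    rw [div_lt_one (by linarith)]; linarith
  have hl : d l = 0 := by
    have := hd l
    simpa [flat] using this
  have hin : ∀ i ∈ J, g i * d i = -(|g i| * |d i|) := by
    intro i hi
    have h2 := hxd i hi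
    have hle : g i * d i ≤ 0 := by
      by_contra! hlt
      have hx2 : 0 < x i * x i := mul_self_pos.2 (by rintro h0; simp [h0] at h2)
      nlinarith [mul_pos hlt hx2, mul_nonneg (hgx i) (neg_nonneg.2 h2.le)]
    rw [← abs_mul, abs_of_nonpos hle, neg_neg]
  obtain ⟨i₁, hi₁, hgi₁⟩ := hne
  obtain ⟨i₀, hi₀, hmin₀⟩ := Finset.exists_min_image J (fun i => |g i|) ⟨i₁, hi₁⟩
  have hinle : ∀ i ∈ J, g i * d i ≤ -(|g i₀| * |d i|) := by
    intro i hi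
    rw [hin i hi]
    exact neg_le_neg (mul_le_mul_of_nonneg_right (hmin₀ i hi) (abs_nonneg _))
  have houtle : ∀ j ∉ J, g j * d j ≤ |g i₀| * |d j| := by
    intro j hj
    by_cases hjl : j = l
    · simp [hjl, hl]
    · refine (le_abs_self _).trans ?_
      rw [abs_mul]
      exact mul_le_mul_of_nonneg_right (hout i₀ hi₀ j hj hjl) (abs_nonneg _)
  rcases eq_or_ne (g i₀) 0 with h0 | h0
  · rw [h0, abs_zero] at hinle houtle
    refine Finset.sum_neg' (fun i _ => ?_) ⟨i₁, Finset.mem_univ _, ?_⟩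
    · by_cases hi : i ∈ J
      · simpa using hinle i hi
      · simpa using houtle i hi
    · rw [hin i₁ hi₁, neg_lt_zero]
      have : d i₁ ≠ 0 := by
        intro h
        have := hxd i₁ hi₁
        simp [h] at this
      positivity
  · have hc : 0 < |g i₀| := abs_pos.2 h0
    have hsum : ∀ S ⊆ Finset.univ.erase l,
        ∑ i ∈ S, |d i| = S.card - (if o ∈ S then 1 - 1 / (n : ℝ) else 0) := by
      intro S hS
      rw [← Finset.sum_ite_eq' S o (fun _ => 1 - 1 / (n : ℝ)), ← nsmul_one S.card,
        ← Finset.sum_const, ← Finset.sum_sub_distrib]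
      refine Finset.sum_congr rfl fun i hi => ?_
      rw [hd, flat, if_neg (Finset.ne_of_mem_erase (hS hi))]
      split_ifs <;> ring
    have hJc : ∑ j ∈ Jᶜ, |d j| = ∑ j ∈ Finset.univ.erase l \ J, |d j| := by
      refine (Finset.sum_subset ?_ ?_).symm
      · intro j hj
        exact Finset.mem_compl.2 (Finset.mem_sdiff.1 hj).2
      · intro j hj hj'
        have : j = l := by
          by_contra h
          exact hj' (by simp [h, Finset.mem_compl.1 hj])
        simp [this, hl]
    have hlt : ∑ j ∈ Jᶜ, |d j| < ∑ i ∈ J, |d i| := by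
      rw [hJc, hsum J hJ, hsum _ Finset.sdiff_subset]
      unfold IsMinority at hmin
      push Not at hmin
      obtain ⟨m1, m2⟩ := hmin
      by_cases ho : o ∈ J
      · have h1 : (Finset.univ.erase l \ J).card + 1 ≤ J.card := by
          by_contra hcon
          exact m2 (by omega) ho
        have h2 : ((Finset.univ.erase l \ J).card : ℝ) + 1 ≤ J.card := by exact_mod_cast h1
        have h3 : o ∉ Finset.univ.erase l \ J := fun h => (Finset.mem_sdiff.1 h).2 ho
        rw [if_pos ho, if_neg h3]
        linarith
      · have h2 : ((Finset.univ.erase l \ J).card : ℝ) ≤ J.card := by exact_mod_cast m1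
        have h3 : o ∈ Finset.univ.erase l \ J := by simp [ho, hol]
        rw [if_neg ho, if_pos h3]
        linarith
    rw [← Finset.sum_add_sum_compl J]
    have s1 := Finset.sum_le_sum hinle
    have s2 := Finset.sum_le_sum (s := Jᶜ) fun j hj => houtle j (Finset.mem_compl.1 hj)
    rw [Finset.sum_neg_distrib, ← Finset.mul_sum] at s1
    rw [← Finset.mul_sum] at s2
    nlinarith [mul_lt_mul_of_pos_left hlt hc]

theorem abs_smul_spike {n : ℕ} {l : Fin n} {A : Finset (Fin n)} {σ : ℝ} (hσ : σ = 1 ∨ σ = -1)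
    (i : Fin n) :
    |(σ • spike l A) i| = if i = l then 0 else if i ∈ A then 1 else 1 / (n : ℝ) := by
  have h : |σ| = 1 := by rcases hσ with rfl | rfl <;> simp
  rw [Pi.smul_apply, smul_eq_mul, abs_mul, h, one_mul, spike]
  split_ifs <;> simp

theorem mul_smul_spike_neg {n : ℕ} {l : Fin n} {J : Finset (Fin n)} {x : Fin n → ℝ} {σ : ℝ}
    (hσ : σ = 1 ∨ σ = -1) {i : Fin n} (hi : i ∈ J) (hil : i ≠ l) (hx : x i ≠ 0) :
    x i * (σ • spike l (J.filter fun i => σ * x i < 0)) i < 0 := by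
  have hn : 0 < (n : ℝ) := by exact_mod_cast i.pos
  have hη : 0 < 1 / (n : ℝ) := by positivity
  have hne : σ * x i ≠ 0 := mul_ne_zero (by rcases hσ with rfl | rfl <;> norm_num) hx
  rw [Pi.smul_apply, smul_eq_mul, spike, if_neg hil]
  by_cases h : σ * x i < 0
  · rw [if_pos (Finset.mem_filter.2 ⟨hi, h⟩)]
    linarith
  · rw [if_neg (show i ∉ J.filter fun i => σ * x i < 0 from
      fun h' => h (Finset.mem_filter.1 h').2)]
    have : 0 < σ * x i := lt_of_le_of_ne (not_lt.1 h) hne.symm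
    nlinarith

/-- The pattern directions contain one that is negative on all normals concentrated on `J`. -/
theorem exists_patternDirection_sum_neg {n : ℕ} {l o : Fin n} (hn : 2 ≤ n) (hol : o ≠ l)
    {x : Fin n → ℝ} {J : Finset (Fin n)} (hJ : J ⊆ Finset.univ.erase l) (hJne : J.Nonempty)
    (hxJ : ∀ i ∈ J, x i ≠ 0) :
    ∃ d ∈ patternDirections l o, ∀ g : Fin n → ℝ, (∀ i, 0 ≤ g i * x i) →
      (∀ i ∈ J, ∀ j ∉ J, j ≠ l → |g j| ≤ |g i|) → (∃ i ∈ J, g i ≠ 0) →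
      ∑ i, g i * d i < 0 := by
  have hspike : ∀ σ : ℝ, (σ = 1 ∨ σ = -1) → (J.filter fun i => σ * x i < 0).Nonempty →
      IsMinority l o (J.filter fun i => σ * x i < 0) →
      ∃ d ∈ patternDirections l o, ∀ g : Fin n → ℝ, (∀ i, 0 ≤ g i * x i) →
      (∀ i ∈ J, ∀ j ∉ J, j ≠ l → |g j| ≤ |g i|) → (∃ i ∈ J, g i ≠ 0) →
      ∑ i, g i * d i < 0 := by
    intro σ hσ hne hmin
    refine ⟨_, smul_spike_mem_patternDirections
      ((Finset.filter_subset _ _).trans hJ) hne hmin hσ, fun g hgx hout hg => ?_⟩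
    obtain ⟨a, ha⟩ := hne
    have haJ := (Finset.mem_filter.1 ha).1
    refine sum_mul_neg_of_dominating (x := x) haJ ?_ hgx ?_ ?_ hg
    · rw [abs_smul_spike hσ, if_neg (Finset.ne_of_mem_erase (hJ haJ)), if_pos ha]
    · exact fun i hi => mul_smul_spike_neg hσ hi (Finset.ne_of_mem_erase (hJ hi)) (hxJ i hi)
    · intro j hj
      rw [abs_mul, abs_smul_spike hσ]
      by_cases hjl : j = l
      · rw [if_pos hjl, mul_zero]; positivity
      · rw [if_neg hjl, if_neg (fun h => hj (Finset.mem_filter.1 h).1), mul_comm]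
        exact mul_le_mul_of_nonneg_left (hout a haJ j hj hjl) (by positivity)
  by_cases hex : ∃ σ : ℝ, (σ = 1 ∨ σ = -1) ∧ (J.filter fun i => σ * x i < 0).Nonempty ∧
      IsMinority l o (J.filter fun i => σ * x i < 0)
  · obtain ⟨σ, hσ, hne, hmin⟩ := hex
    exact hspike σ hσ hne hmin
  obtain ⟨σ, hσ, hpos⟩ : ∃ σ : ℝ, (σ = 1 ∨ σ = -1) ∧ ∀ i ∈ J, σ * x i < 0 := by
    have hor := isMinority_or_isMinority (l := l) (o := o) hol
      ((Finset.filter_subset (fun i => 1 * x i < 0) J).trans hJ)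
      ((Finset.filter_subset (fun i => -1 * x i < 0) J).trans hJ)
      (Finset.disjoint_filter.2 fun i _ h => by linarith)
    push Not at hex
    rcases hor with h | h
    · refine ⟨-1, Or.inr rfl, fun i hi => ?_⟩
      have h0 : ¬ (1 * x i < 0) := fun hlt =>
        hex 1 (Or.inl rfl) ⟨i, Finset.mem_filter.2 ⟨hi, hlt⟩⟩ h
      have := lt_of_le_of_ne (not_lt.1 h0) (by simpa using (hxJ i hi).symm)
      linarith
    · refine ⟨1, Or.inl rfl, fun i hi => ?_⟩
      have h0 : ¬ (-1 * x i < 0) := fun hlt =>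
        hex (-1) (Or.inr rfl) ⟨i, Finset.mem_filter.2 ⟨hi, hlt⟩⟩ h
      have := lt_of_le_of_ne (not_lt.1 h0) (by simpa using (hxJ i hi))
      linarith
  have hfil : (J.filter fun i => σ * x i < 0) = J := Finset.filter_true_of_mem hpos
  have hmin : ¬ IsMinority l o J := by
    intro h
    exact hex ⟨σ, hσ, by rwa [hfil], by rwa [hfil]⟩
  refine ⟨_, smul_flat_mem_patternDirections hol hσ, fun g hgx hout hg => ?_⟩
  have hfl : ∀ i, 0 ≤ flat l o i := by
    intro i
    unfold flat
    split_ifs <;> positivity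
  refine sum_mul_neg_of_flat (x := x) hn hol hJ (fun i => ?_) hgx (fun i hi => ?_) hout hg hmin
  · have h : |σ| = 1 := by rcases hσ with rfl | rfl <;> simp
    rw [Pi.smul_apply, smul_eq_mul, abs_mul, h, one_mul, abs_of_nonneg (hfl i)]
  · have hpos' : 0 < flat l o i := by
      have hn' : (0 : ℝ) < n := by exact_mod_cast i.pos
      rw [flat, if_neg (Finset.ne_of_mem_erase (hJ hi))]
      split_ifs <;> positivity
    rw [Pi.smul_apply, smul_eq_mul]
    nlinarith [hpos i hi]

/-- The sparse directions contain one that is negative on all normals concentrated on a small set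
`I` containing `l`. -/
theorem exists_sparseDirection_sum_neg {n : ℕ} {l : Fin n} {x : Fin n → ℝ} {I : Finset (Fin n)}
    (hl : l ∈ I) (hI : 2 * I.card ≤ n) (hxI : ∀ i ∈ I, x i ≠ 0) :
    ∃ d ∈ sparseDirections l ((n - 2) / 4), ∀ g : Fin n → ℝ, (∀ i, 0 ≤ g i * x i) →
      (∀ i ∈ I, ∀ j ∉ I, |g j| ≤ |g i|) → (∃ i ∈ I, g i ≠ 0) →
      ∑ i, g i * d i < 0 := by
  obtain ⟨σ, hσ, hcard⟩ : ∃ σ : ℝ, (σ = 1 ∨ σ = -1) ∧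
      ((I.erase l).filter fun i => σ * x i < 0).card ≤ (n - 2) / 4 := by
    have hd : Disjoint ((I.erase l).filter fun i => 1 * x i < 0)
        ((I.erase l).filter fun i => -1 * x i < 0) :=
      Finset.disjoint_filter.2 fun i _ h => by linarith
    have h1 := Finset.card_le_card (Finset.union_subset
      (Finset.filter_subset (fun i => 1 * x i < 0) (I.erase l))
      (Finset.filter_subset (fun i => -1 * x i < 0) (I.erase l)))
    rw [Finset.card_union_of_disjoint hd, Finset.card_erase_of_mem hl] at h1
    have h2 := Finset.card_pos.2 ⟨l, hl⟩
    by_cases h : ((I.erase l).filter fun i => 1 * x i < 0).card ≤ (n - 2) / 4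
    · exact ⟨1, Or.inl rfl, h⟩
    · exact ⟨-1, Or.inr rfl, by omega⟩
  obtain ⟨τ, hτ, hτx⟩ : ∃ τ : ℝ, (τ = 1 ∨ τ = -1) ∧ x l * τ < 0 := by
    rcases lt_or_gt_of_ne (hxI l hl) with h | h
    · exact ⟨1, Or.inl rfl, by linarith⟩
    · exact ⟨-1, Or.inr rfl, by linarith⟩
  refine ⟨_, update_spike_mem_sparseDirections ((Finset.filter_subset _ _).trans
    (Finset.erase_subset_erase l (Finset.subset_univ I))) hcard hσ hτ, fun g hgx hout hg => ?_⟩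
  refine sum_mul_neg_of_dominating (x := x) hl ?_ hgx ?_ ?_ hg
  · rw [Function.update_self]
    rcases hτ with rfl | rfl <;> simp
  · intro i hi
    by_cases hil : i = l
    · rw [hil, Function.update_self]; exact hτx
    · rw [Function.update_of_ne hil]
      exact mul_smul_spike_neg hσ (Finset.mem_erase.2 ⟨hil, hi⟩) hil (hxI i hi)
  · intro j hj
    have hjl : j ≠ l := fun h => hj (h ▸ hl)
    rw [Function.update_of_ne hjl, abs_mul, abs_smul_spike hσ, if_neg hjl,
      if_neg (fun h => hj (Finset.mem_of_mem_erase (Finset.mem_filter.1 h).1)), mul_comm]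
    exact mul_le_mul_of_nonneg_left (hout l hl j hj) (by positivity)

/-- A 1-symmetric convex set having a point with all coordinates in `I` of absolute value at
least `1` contains the unit cube vertex on the first `|I|` coordinates. -/
theorem initial_indicator_mem {n : ℕ} {B : Set (Fin n → ℝ)} (hconv : Convex ℝ B)
    (hB : ∀ x ∈ B, ∀ σ : Equiv.Perm (Fin n), ∀ ε : Fin n → ℝ,
      (∀ i, ε i = 1 ∨ ε i = -1) → (fun i => ε i * x (σ i)) ∈ B)
    {x : Fin n → ℝ} (hx : x ∈ B) {I : Finset (Fin n)} (hI : ∀ i ∈ I, 1 ≤ |x i|) :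
    (fun i : Fin n => if (i : ℕ) < I.card then (1 : ℝ) else 0) ∈ B := by
  have h1 : (fun i => if i ∈ I then (1 : ℝ) else 0) ∈ B := by
    refine mem_of_forall_abs_le hconv (fun y hy ε hε => hB y hy 1 ε hε) hx fun i => ?_
    split_ifs with h
    · simpa using hI i h
    · simp
  have hcard : Fintype.card {i : Fin n // (i : ℕ) < I.card} = Fintype.card {i // i ∈ I} := by
    have hle : I.card ≤ n := by simpa using I.card_le_univ
    rw [Fintype.card_coe, Fintype.card_subtype]
    have := Fin.card_filter_val_lt (n := n) (m := I.card)
    omega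
  let e := Fintype.equivOfCardEq hcard
  have h2 := hB _ h1 e.extendSubtype (fun _ => 1) (fun _ => Or.inl rfl)
  convert h2 using 1
  ext i
  by_cases h : (i : ℕ) < I.card
  · simp [h, e.extendSubtype_mem i h]
  · simp [h, e.extendSubtype_not_mem i h]

/-- Theorem: for `n ≥ 4`, a body `B ∈ 𝒮ⁿ` containing no unit subcube of dimension `> n/2`
(that is, every `k` with `e₁ + ⋯ + e_k ∈ B` satisfies `2k ≤ n`) can be illuminated by a set
of at most `2^(n-1) + 4·∑_{s=0}^{⌊(n-2)/4⌋} C(n-1,s)` directions, hence `𝔍(B) ≤ 2ⁿ - 4`. -/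
theorem stmt_13 {n : ℕ} (hn : 4 ≤ n) (B : Set (Fin n → ℝ))
    (hB_conv : Convex ℝ B) (hB_comp : IsCompact B) (hB_int : (interior B).Nonempty)
    (hB_sym : ∀ x ∈ B, ∀ σ : Equiv.Perm (Fin n), ∀ ε : Fin n → ℝ,
      (∀ i, ε i = 1 ∨ ε i = -1) → (fun i => ε i * x (σ i)) ∈ B)
    (hB_norm : ∀ i : Fin n, (Pi.single i (1 : ℝ) : Fin n → ℝ) ∈ frontier B)
    (hsmall : ∀ k : ℕ, k ≤ n →
      (fun i : Fin n => if (i : ℕ) < k then (1 : ℝ) else 0) ∈ B → 2 * k ≤ n) :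
    ∃ D : Finset (Fin n → ℝ),
      D.card ≤ 2 ^ (n - 1) + 4 * (∑ s ∈ Finset.range ((n - 2) / 4 + 1), (n - 1).choose s) ∧
      D.card ≤ 2 ^ n - 4 ∧
      ∀ x ∈ frontier B, ∃ d ∈ D, ∃ ε : ℝ, 0 < ε ∧ x + ε • d ∈ interior B := by
  classical
  set l : Fin n := ⟨0, by omega⟩ with hl_def
  set o : Fin n := ⟨1, by omega⟩ with ho_def
  have hol : o ≠ l := by simp [hl_def, ho_def]
  have hcard : (patternDirections l o ∪ sparseDirections l ((n - 2) / 4)).card ≤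
      2 ^ (n - 1) + 4 * (∑ s ∈ Finset.range ((n - 2) / 4 + 1), (n - 1).choose s) :=
    (Finset.card_union_le _ _).trans
      (Nat.add_le_add (card_patternDirections_le l o) (card_sparseDirections_le l _))
  refine ⟨_, hcard, hcard.trans (card_bound hn), fun x hx => ?_⟩
  have hclosed : IsClosed B := hB_comp.isClosed
  have hxB : x ∈ B := hclosed.frontier_subset hx
  have hneg : ∀ y ∈ B, -y ∈ B := by
    intro y hy
    convert hB_sym y hy 1 (fun _ => -1) (fun _ => Or.inr rfl) using 1
    ext i
    simp
  suffices h : ∃ d ∈ patternDirections l o ∪ sparseDirections l ((n - 2) / 4),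
      ∀ g : Fin n → ℝ, (∀ y ∈ B, ∑ i, g i * y i ≤ ∑ i, g i * x i) →
        0 < ∑ i, g i * x i → ∑ i, g i * d i < 0 by
    obtain ⟨d, hd, h⟩ := h
    exact ⟨d, hd, exists_add_smul_mem_interior_of_forall_normal hB_conv hB_int hneg hxB h⟩
  obtain ⟨m, -, hm⟩ := Finset.exists_max_image Finset.univ (fun i => |x i|) ⟨l, Finset.mem_univ l⟩
  set I : Finset (Fin n) := Finset.univ.filter fun i => |x i| = |x m| with hI_def
  have hmemI : ∀ i, i ∈ I ↔ |x i| = |x m| := fun i => by simp [hI_def]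
  have hmI : m ∈ I := (hmemI m).2 rfl
  by_cases hxm : x m = 0
  · refine ⟨flat l o, Finset.mem_union_left _ (by
      simpa using smul_flat_mem_patternDirections hol (Or.inl rfl)), fun g _ hg => ?_⟩
    have h0 : ∀ i, x i = 0 := fun i => by
      have := hm i (Finset.mem_univ i)
      rwa [hxm, abs_zero, abs_nonpos_iff] at this
    simp [h0] at hg
  have hxI : ∀ i ∈ I, x i ≠ 0 := by
    intro i hi
    rw [← abs_pos, (hmemI i).1 hi]
    exact abs_pos.2 hxm
  have hdom : ∀ g : Fin n → ℝ, (∀ y ∈ B, ∑ i, g i * y i ≤ ∑ i, g i * x i) →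
      ∀ i ∈ I, ∀ j ∉ I, |g j| ≤ |g i| := by
    intro g hg i hi j hj
    refine abs_normal_le_of_abs_lt hB_sym hxB hg ?_
    rw [(hmemI i).1 hi]
    exact lt_of_le_of_ne (hm j (Finset.mem_univ j)) fun h => hj ((hmemI j).2 h)
  have hgI : ∀ g : Fin n → ℝ, (∀ y ∈ B, ∑ i, g i * y i ≤ ∑ i, g i * x i) →
      0 < ∑ i, g i * x i → ∃ i ∈ I, g i ≠ 0 := by
    intro g hg hpos
    by_contra! hcon
    have h0 : ∀ i, g i = 0 := by
      intro i
      by_cases hi : i ∈ I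
      · exact hcon i hi
      · have := hdom g hg m hmI i hi
        rwa [hcon m hmI, abs_zero, abs_nonpos_iff] at this
    simp [h0] at hpos
  by_cases hcase : l ∈ I ∧ 2 * I.card ≤ n
  · obtain ⟨d, hd, h⟩ := exists_sparseDirection_sum_neg hcase.1 hcase.2 hxI
    exact ⟨d, Finset.mem_union_right _ hd, fun g hg hpos =>
      h g (normal_mul_nonneg hB_sym hxB hg) (hdom g hg) (hgI g hg hpos)⟩
  have hlI : l ∈ I → n < 2 * I.card := by
    intro h
    by_contra hcon
    exact hcase ⟨h, by omega⟩
  have hJne : (I.erase l).Nonempty := by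
    by_cases h : l ∈ I
    · rw [← Finset.card_pos, Finset.card_erase_of_mem h]
      have := hlI h
      omega
    · rw [Finset.erase_eq_of_notMem h]
      exact ⟨m, hmI⟩
  obtain ⟨d, hd, h⟩ := exists_patternDirection_sum_neg (x := x) (by omega : 2 ≤ n) hol
    (Finset.erase_subset_erase l (Finset.subset_univ I)) hJne
    (fun i hi => hxI i (Finset.mem_of_mem_erase hi))
  refine ⟨d, Finset.mem_union_left _ hd, fun g hg hpos => ?_⟩
  have hdomJ : ∀ i ∈ I.erase l, ∀ j ∉ I.erase l, j ≠ l → |g j| ≤ |g i| := by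
    intro i hi j hj hjl
    exact hdom g hg i (Finset.mem_of_mem_erase hi) j fun h => hj (Finset.mem_erase.2 ⟨hjl, h⟩)
  refine h g (normal_mul_nonneg hB_sym hxB hg) hdomJ ?_
  by_contra! hcon
  have hl : l ∈ I := by
    by_contra hl
    obtain ⟨i, hi, hgi⟩ := hgI g hg hpos
    exact hgi (hcon i (by rwa [Finset.erase_eq_of_notMem hl]))
  have hg0 : ∀ i, i ≠ l → g i = 0 := by
    intro i hil
    by_cases hi : i ∈ I.erase l
    · exact hcon i hi
    · obtain ⟨j, hj⟩ := hJne
      have := hdomJ j hj i hi hil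
      rwa [hcon j hj, abs_zero, abs_nonpos_iff] at this
  have hlt : |x m| < 1 := by
    by_contra! hge
    have := hsmall I.card (by simpa using I.card_le_univ)
      (initial_indicator_mem hB_conv hB_sym hxB fun i hi => by rwa [(hmemI i).1 hi])
    have := hlI hl
    omega
  have hsum : ∀ y : Fin n → ℝ, ∑ i, g i * y i = g l * y l := fun y =>
    Finset.sum_eq_single l (fun i _ hi => by rw [hg0 i hi, zero_mul]) (by simp)
  have hel : (Pi.single l (1 : ℝ) : Fin n → ℝ) ∈ B := hclosed.frontier_subset (hB_norm l)
  have h1 := hg _ hel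
  have h2 := hg _ (hneg _ hel)
  rw [hsum, hsum] at h1 h2
  rw [hsum] at hpos
  simp only [Pi.neg_apply, Pi.single_eq_same] at h1 h2
  have h3 : |g l| ≤ g l * x l := abs_le'.2 ⟨by linarith, by linarith⟩
  have h4 : g l * x l ≤ |g l| * |x m| := by
    rw [← (hmemI l).1 hl, ← abs_mul]
    exact le_abs_self _
  have h5 : 0 < |g l| := abs_pos.2 (by rintro h0; simp [h0] at hpos)
  nlinarith
end

section
/- Let n ≥ 3 and δ ∈ (0,1). There exists a subset 𝓘 of Gⁿ(δ) with cardinality |𝓘| = 2ⁿ − 2 which is symmetric (𝓘 = −𝓘) and which deep illuminates every vector x ∈ ℝⁿ \ {0} having at least one zero coordinate: for each such x there is d ∈ 𝓘 with sign(d_i) = −sign(x_i) for every i with x_i ≠ 0 and with the coordinate of d of absolute value 1 occurring at an index j with x_j ≠ 0. -/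
/-- The sign pattern equal to `s` on the first `k` coordinates and to `!s` on the others. -/
def stepPattern (n : ℕ) (s : Bool) (k : ℕ) : Fin n → Bool :=
  fun i => if i.val < k then s else !s

/-- Let `b` record which coordinates of a nonconstant sign pattern agree with the first one. A
coordinate is selected: one agreeing with the first and preceded by a disagreement, if there
is any; otherwise the first disagreement, or the coordinate `0` if that disagreement is the last
coordinate. -/
lemma exists_selected_coordinate (m : ℕ) (b : Fin (m + 3) → Bool) :
    ∃ r : Fin (m + 3),
      ((∃ i j, j < i ∧ b i = true ∧ b j = false) →
        b r = true ∧ ∃ j, j < r ∧ b j = false) ∧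
      ∀ k : Fin (m + 3), (∀ i, b i = true ↔ i < k) →
        r = if k.val + 1 < m + 3 then k else 0 := by
  by_cases h : ∃ i j, j < i ∧ b i = true ∧ b j = false
  · obtain ⟨i, j, hji, hi, hj⟩ := h
    refine ⟨i, fun _ => ⟨hi, j, hji, hj⟩, fun k hk => ?_⟩
    have h1 := (hk i).1 hi
    have h2 := (hk j).2 (hji.trans h1)
    simp [hj] at h2
  · by_cases h' : ∃ k : Fin (m + 3), ∀ i, b i = true ↔ i < k
    · obtain ⟨k, hk⟩ := h'
      refine ⟨if k.val + 1 < m + 3 then k else 0, fun h'' => absurd h'' h, fun l hl => ?_⟩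
      have : k = l := by
        have h1 := (hk k).symm.trans (hl k)
        have h2 := (hk l).symm.trans (hl l)
        simp only [lt_irrefl, false_iff, iff_false, not_lt] at h1 h2
        exact le_antisymm h2 h1
      rw [this]
    · exact ⟨0, fun h'' => absurd h'' h, fun k hk => absurd ⟨k, hk⟩ h'⟩

/-- To sign patterns one can assign coordinates, equally for opposite patterns, such that
every prescription of signs on a nonempty proper set `S` of coordinates extends to a nonconstant
pattern whose coordinate lies in `S`. -/
lemma exists_coordinate_assignment (m : ℕ) :
    ∃ p : (Fin (m + 3) → Bool) → Fin (m + 3),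
      (∀ a, p (fun i => !a i) = p a) ∧
      ∀ (S : Set (Fin (m + 3))) (y : Fin (m + 3) → Bool), S.Nonempty → (∃ i, i ∉ S) →
        ∃ a, (∃ i, a i ≠ a 0) ∧ (∀ i ∈ S, a i = y i) ∧ p a ∈ S := by
  choose q hq1 hq2 using exists_selected_coordinate m
  refine ⟨fun a => q (fun i => a i == a 0), fun a => ?_, fun S y ⟨u, hu⟩ ⟨v, hv⟩ => ?_⟩
  · refine congrArg q (funext fun i => ?_)
    beta_reduce
    cases a i <;> cases a 0 <;> rfl
  by_contra! hclosed
  have hstep_mem : ∀ s k, 1 ≤ k → k < m + 3 → (∀ i ∈ S, stepPattern (m + 3) s k i = y i) →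
      (if k + 1 < m + 3 then Fin.ofNat (m + 3) k else 0) ∉ S := by
    intro s k hk1 hk h
    have h0 : stepPattern (m + 3) s k 0 = s := by
      simp [stepPattern, show 0 < k by omega]
    have hval : (Fin.ofNat (m + 3) k).val = k := Nat.mod_eq_of_lt hk
    have := hclosed (stepPattern (m + 3) s k) ⟨⟨k, hk⟩, by rw [h0]; simp [stepPattern]⟩ h
    rw [hq2 _ (Fin.ofNat (m + 3) k), hval] at this
    · exact this
    · intro i
      rw [h0, Fin.lt_def, hval]
      by_cases hi : i.val < k <;> simp [stepPattern, hi]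
  have hsucc : ∀ s k, 1 ≤ k → k + 1 < m + 3 → (∀ i ∈ S, stepPattern (m + 3) s k i = y i) →
      ∀ i ∈ S, stepPattern (m + 3) s (k + 1) i = y i := by
    intro s k hk1 hk h i hi
    have h1 := hstep_mem s k hk1 (by omega) h
    rw [if_pos hk] at h1
    have h2 : i.val ≠ k := by
      rintro h2
      apply h1
      convert hi
      ext
      rw [h2]
      exact Nat.mod_eq_of_lt (by omega)
    rw [← h i hi]
    have : i.val < k + 1 ↔ i.val < k := by omega
    simp [stepPattern, this]
  have hmono : ∀ s k l, 1 ≤ k → k ≤ l → l < m + 3 →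
      (∀ i ∈ S, stepPattern (m + 3) s k i = y i) →
      ∀ i ∈ S, stepPattern (m + 3) s l i = y i := by
    intro s k l hk hkl
    induction l, hkl using Nat.le_induction with
    | base => exact fun _ h => h
    | succ l hkl ih => exact fun hl h => hsucc s l (by omega) hl (ih (by omega) h)
  have hstart : ∃ s k, 1 ≤ k ∧ k < m + 3 ∧ ∀ i ∈ S, stepPattern (m + 3) s k i = y i := by
    have key : ∀ (N : ℕ) (a : Fin (m + 3) → Bool),
        (Finset.univ.filter fun i => a i = a 0).card = N → (∃ i, a i ≠ a 0) →
        (∀ i ∈ S, a i = y i) →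
        ∃ s k, 1 ≤ k ∧ k < m + 3 ∧ ∀ i ∈ S, stepPattern (m + 3) s k i = y i := by
      intro N
      induction N using Nat.strong_induction_on with
      | _ N ih =>
        intro a hN ha hS
        by_cases hd : ∃ i j, j < i ∧ (a i == a 0) = true ∧ (a j == a 0) = false
        · obtain ⟨hr, j, hj, haj⟩ := hq1 (fun i => a i == a 0) hd
          have hrS := hclosed a ha hS
          generalize q (fun i => a i == a 0) = r at *
          have hr0 : (0 : Fin (m + 3)) ≠ r := by
            rintro rfl
            exact absurd hj (Fin.not_lt_zero j)
          have hc0 : Function.update a r (!a r) 0 = a 0 := Function.update_of_ne hr0 _ _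
          refine ih _ ?_ (Function.update a r (!a r)) rfl ⟨j, ?_⟩ ?_
          · rw [← hN]
            apply Finset.card_lt_card
            rw [Finset.ssubset_iff_of_subset]
            · refine ⟨r, by simpa using hr, ?_⟩
              simp only [Finset.mem_filter, hc0]
              simpa using hr
            · intro i
              simp only [Finset.mem_filter, hc0]
              by_cases hir : i = r
              · subst hir; simpa using fun _ => hr
              · simp [Function.update_of_ne hir]
          · rw [hc0, Function.update_of_ne hj.ne]
            simpa using haj
          · intro i hi
            rw [Function.update_of_ne (by rintro rfl; exact hrS hi)]
            exact hS i hi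
        · have hex : ∃ k, ∃ h : k < m + 3, a ⟨k, h⟩ ≠ a 0 := by
            obtain ⟨i, hi⟩ := ha
            exact ⟨i, i.2, hi⟩
          classical
          obtain ⟨hk, hak⟩ := Nat.find_spec hex
          refine ⟨a 0, Nat.find hex, ?_, hk, fun i hi => ?_⟩
          · by_contra h0
            have h0 : Nat.find hex = 0 := by omega
            apply hak
            congr 1
            ext
            simp [h0]
          · rw [← hS i hi]
            by_cases hik : i.val < Nat.find hex
            · have := Nat.find_min hex hik
              push Not at this
              simp [stepPattern, hik, this i.2]
            · have hne : a i ≠ a 0 := by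
                intro hai
                rcases (not_lt.1 hik).lt_or_eq with h | h
                · exact hd ⟨i, ⟨_, hk⟩, h, by simp [hai], by simpa using hak⟩
                · apply hak
                  exact (congrArg a (Fin.ext h)).trans hai
              simp only [stepPattern, hik, if_false]
              revert hne
              cases a i <;> cases a 0 <;> simp
    classical
    let a : Fin (m + 3) → Bool := fun i => if i ∈ S then y i else !(y u)
    refine key _ a rfl ?_ fun i hi => if_pos hi
    by_contra! h
    have h1 : a u = a v := (h u).trans (h v).symm
    simp [a, hu, hv] at h1
  obtain ⟨s, k, hk1, hk, hsk⟩ := hstart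
  have hlast := hmono s k (m + 2) hk1 (by omega) (by omega) hsk
  have h0S := hstep_mem s (m + 2) (by omega) (by omega) hlast
  simp only [lt_irrefl, if_false] at h0S
  let c : Fin (m + 3) → Bool := Function.update (stepPattern (m + 3) s (m + 2)) 0 (!s)
  have hc0 : c 0 = !s := Function.update_self ..
  have hcl : c (Fin.last _) = !s := by
    simp only [c]
    rw [Function.update_of_ne (by simp [Fin.ext_iff])]
    simp [stepPattern]
  have hcm : ∀ i, i ≠ 0 → i ≠ Fin.last _ → c i = s := by
    intro i h1 h2
    have : i.val < m + 2 := by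
      have := Fin.val_lt_last h2
      exact this
    simp only [c]
    rw [Function.update_of_ne h1]
    simp [stepPattern, this]
  have hcS : ∀ i ∈ S, c i = y i := by
    intro i hi
    simp only [c]
    rw [Function.update_of_ne (by rintro rfl; exact h0S hi)]
    exact hlast i hi
  have hone : c 1 = s := hcm 1 (by simp) (by simp [Fin.ext_iff])
  have hlS : Fin.last (m + 2) ∉ S := by
    have h1 := hclosed c ⟨1, by rw [hone, hc0]; simp⟩ hcS
    obtain ⟨hr, j, hj, -⟩ := hq1 (fun i => c i == c 0)
      ⟨Fin.last _, 1, by simp [Fin.lt_def], by simp [hcl, hc0], by simp [hone, hc0]⟩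
    generalize q (fun i => c i == c 0) = r at *
    by_cases hrl : r = Fin.last _
    · rwa [hrl] at h1
    · have h0 : r ≠ 0 := by rintro rfl; exact Fin.not_lt_zero j hj
      simp [hcm r h0 hrl, hc0] at hr
  have hfirst : ∀ i ∈ S, stepPattern (m + 3) (!s) 1 i = y i := by
    intro i hi
    have h1 : i ≠ 0 := by rintro rfl; exact h0S hi
    have h2 : i ≠ Fin.last _ := by rintro rfl; exact hlS hi
    rw [← hcS i hi, hcm i h1 h2]
    simp [stepPattern, h1]
  have hu0 : u.val ≠ 0 := fun h => h0S (by convert hu; exact Fin.ext h.symm)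
  have hul : u.val ≠ m + 2 := fun h => hlS (by convert hu; exact Fin.ext h.symm)
  have h1 := hstep_mem (!s) u.val (by omega) u.2
    (hmono (!s) 1 u.val le_rfl (by omega) u.2 hfirst)
  rw [if_pos (by omega), Fin.ofNat_val_eq_self] at h1
  exact h1 hu

/-- Lemma: for `n ≥ 3` and `δ ∈ (0,1)` there is a symmetric subset `𝓘 ⊆ Gⁿ(δ)` of
cardinality `2ⁿ - 2` which deep illuminates every nonzero vector with at least one zero
coordinate. -/
theorem stmt_15 {n : ℕ} (hn : 3 ≤ n) (δ : ℝ) (hδ : δ ∈ Set.Ioo (0 : ℝ) 1) :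
    ∃ I : Finset (Fin n → ℝ),
      (∀ d ∈ I, ∃ i : Fin n, |d i| = 1 ∧ ∀ j, j ≠ i → |d j| = δ) ∧
      I.card = 2 ^ n - 2 ∧
      (∀ d ∈ I, -d ∈ I) ∧
      ∀ x : Fin n → ℝ, x ≠ 0 → (∃ i, x i = 0) →
        ∃ d ∈ I, (∀ i, x i ≠ 0 → Real.sign (d i) = -Real.sign (x i)) ∧
          ∃ j, x j ≠ 0 ∧ |d j| = 1 := by
  obtain ⟨m, rfl⟩ : ∃ m, n = m + 3 := ⟨n - 3, by omega⟩
  obtain ⟨hδ0, hδ1⟩ := hδ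
  obtain ⟨p, hp, hS⟩ := exists_coordinate_assignment m
  classical
  let d : (Fin (m + 3) → Bool) → Fin (m + 3) → ℝ := fun a i =>
    (if a i then 1 else -1) * (if i = p a then 1 else δ)
  have hsign : ∀ a i, Real.sign (d a i) = if a i then 1 else -1 := by
    intro a i
    have hpos : (0 : ℝ) < if i = p a then 1 else δ := by split_ifs <;> linarith
    simp only [d]
    split_ifs at hpos ⊢ with h1
    all_goals first
      | exact Real.sign_of_pos (by linarith)
      | exact Real.sign_of_neg (by linarith)
  have habs : ∀ a i, |d a i| = if i = p a then 1 else δ := by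
    intro a i
    simp only [d]
    split_ifs <;> simp [abs_of_pos hδ0]
  have hinj : Function.Injective d := by
    intro a b hab
    funext i
    have h := hsign a i
    rw [hab, hsign b i] at h
    revert h
    cases a i <;> cases b i <;> norm_num
  refine ⟨(Finset.univ.filter fun a : Fin (m + 3) → Bool => ∃ i, a i ≠ a 0).image d,
    ?_, ?_, ?_, ?_⟩
  · simp only [Finset.mem_image, forall_exists_index, and_imp]
    rintro _ a - rfl
    exact ⟨p a, by simp [habs], fun j hj => by simp [habs, hj]⟩
  · rw [Finset.card_image_of_injective _ hinj]
    have : (Finset.univ.filter fun a : Fin (m + 3) → Bool => ∃ i, a i ≠ a 0) =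
        ({fun _ => true, fun _ => false} : Finset (Fin (m + 3) → Bool))ᶜ := by
      ext a
      simp only [Finset.mem_filter, Finset.mem_univ, true_and, Finset.mem_compl,
        Finset.mem_insert, Finset.mem_singleton, ← not_forall_not, not_not]
      refine not_congr ⟨fun h => ?_, ?_⟩
      · cases h0 : a 0
        · exact Or.inr (funext fun i => (h i).trans h0)
        · exact Or.inl (funext fun i => (h i).trans h0)
      · rintro (rfl | rfl) <;> simp
    rw [this, Finset.card_compl, Finset.card_pair]
    · simp
    · exact fun h => by simpa using congrFun h 0
  · simp only [Finset.mem_image, forall_exists_index, and_imp, Finset.mem_filter,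
      Finset.mem_univ, true_and]
    rintro _ a i hi rfl
    refine ⟨fun i => !a i, ⟨i, by simpa using hi⟩, ?_⟩
    funext j
    simp only [d, hp, Pi.neg_apply]
    rw [← neg_mul]
    congr 1
    by_cases h : a j = true <;> simp [h]
  · intro x hx ⟨v, hv⟩
    obtain ⟨u, hu⟩ := Function.ne_iff.1 hx
    obtain ⟨a, ha, hay, hap⟩ := hS {i | x i ≠ 0} (fun i => decide (x i < 0)) ⟨u, hu⟩
      ⟨v, by simpa using hv⟩
    refine ⟨d a, Finset.mem_image_of_mem _ (by simpa using ha), fun i hi => ?_,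
      p a, hap, by simp [habs]⟩
    rw [hsign, hay i hi]
    rcases lt_or_gt_of_ne hi with h | h
    · simp [h, Real.sign_of_neg]
    · simp [h.le, Real.sign_of_pos h]
end
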